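/- arXiv:1312.6305 — 5 statements merged into one kernel-verified Lean document; each statement's English description precedes it below -/
import Mathlib

section
/- Let n ≥ 1 be an integer, let k ≥ 1 be a real number, and let X be a binomial random variable with parameters n and 1/k. Let β be a real number with 1 < β ≤ k, and define ε(μ, β) = (e^{β−1}/β^{β})^{μ}. Then the tail sum ∑_{t ∈ ℕ, t > βn/k} t · Pr[X = t] is at most ε(n/k, β) · ( βn/k + 1 + β/(β − e^{1−1/β}) ). (Note that β − e^{1−1/β} > 0 for β > 1.) -/
open Finset in
/-- The probability generating function of a binomial distribution, bounded by an exponential. -/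
theorem sum_pow_mul_binomial_le_exp (n : ℕ) (p β : ℝ) (hp : 0 ≤ p) (hβ : 1 ≤ β) :
    ∑ t ∈ range (n + 1), β ^ t * ((n.choose t : ℝ) * p ^ t * (1 - p) ^ (n - t))
      ≤ Real.exp ((β - 1) * (n * p)) := by
  have hpgf : ∑ t ∈ range (n + 1), β ^ t * ((n.choose t : ℝ) * p ^ t * (1 - p) ^ (n - t))
      = (1 + (β - 1) * p) ^ n := by
    rw [show 1 + (β - 1) * p = β * p + (1 - p) by ring, add_pow]
    refine sum_congr rfl fun t _ => ?_
    rw [mul_pow]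
    ring
  have hnonneg : 0 ≤ (β - 1) * p := mul_nonneg (by linarith) hp
  calc _ = (1 + (β - 1) * p) ^ n := hpgf
    _ ≤ Real.exp ((β - 1) * p) ^ n := by
        gcongr
        linarith [Real.add_one_le_exp ((β - 1) * p)]
    _ = _ := by
        rw [← Real.exp_nat_mul]
        ring_nf

/-- An exponential majorant of the identity to the right of `a`. -/
theorem le_rpow_sub_mul_add (β a x : ℝ) (hβ : 1 < β) (ha : 0 ≤ a) (hx : a ≤ x) :
    x ≤ β ^ (x - a) * (a + β / (β - 1)) := by
  have hβ₁ : 0 < β - 1 := by linarith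
  have hβ₀ : 0 < β := by linarith
  have hrpow : 1 + (x - a) * ((β - 1) / β) ≤ β ^ (x - a) := by
    have hlog : (β - 1) / β ≤ Real.log β := by
      have := Real.one_sub_inv_le_log_of_pos hβ₀
      rwa [sub_div, div_self hβ₀.ne', one_div]
    rw [Real.rpow_def_of_pos hβ₀]
    have := Real.add_one_le_exp (Real.log β * (x - a))
    nlinarith [mul_le_mul_of_nonneg_left hlog (sub_nonneg.2 hx)]
  have hc : 0 < β / (β - 1) := by positivity
  have hinv : (β - 1) / β * (β / (β - 1)) = 1 := by field_simp
  have hu : 0 ≤ (x - a) * ((β - 1) / β) * a :=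
    mul_nonneg (mul_nonneg (sub_nonneg.2 hx) (by positivity)) ha
  calc x ≤ (1 + (x - a) * ((β - 1) / β)) * (a + β / (β - 1)) := by
        linear_combination hu + hc.le - (x - a) * hinv
    _ ≤ _ := by gcongr

theorem div_sub_one_le_one_add_div_sub_exp (β : ℝ) (hβ : 1 < β) :
    β / (β - 1) ≤ 1 + β / (β - Real.exp (1 - 1 / β)) := by
  have hβ₁ : 0 < β - 1 := by linarith
  have hβ₀ : 0 < β := by linarith
  have hinv : 1 / β < 1 := by rwa [div_lt_one hβ₀]
  have hpos : 0 < β - Real.exp (1 - 1 / β) := by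
    have hlog := Real.log_lt_sub_one_of_pos (one_div_pos.2 hβ₀) hinv.ne
    rw [one_div, Real.log_inv] at hlog
    rw [sub_pos, ← Real.lt_log_iff_exp_lt hβ₀, one_div]
    linarith
  have hexp : 1 ≤ Real.exp (1 - 1 / β) := Real.one_le_exp (by linarith)
  have hle : 1 / (β - 1) ≤ β / (β - Real.exp (1 - 1 / β)) :=
    div_le_div₀ hβ₀.le hβ.le hpos (by linarith)
  have hsplit : β / (β - 1) = 1 + 1 / (β - 1) := by
    field_simp
    ring
  linarith

/-- tail-sum bound for a binomial random variable (Proposition 2.2). -/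
theorem binomial_tail_sum_bound (n : ℕ) (hn : 1 ≤ n) (k β : ℝ) (hk : 1 ≤ k)
    (hβ : 1 < β) (hβk : β ≤ k) :
    (∑ t ∈ (Finset.range (n + 1)).filter (fun t : ℕ => β * n / k < (t : ℝ)),
        (t : ℝ) * ((n.choose t : ℝ) * (1 / k) ^ t * (1 - 1 / k) ^ (n - t)))
      ≤ (Real.exp (β - 1) / β ^ β) ^ ((n : ℝ) / k) *
        (β * n / k + 1 + β / (β - Real.exp (1 - 1 / β))) := by
  have hk₀ : 0 < k := by linarith
  have hβ₀ : 0 < β := by linarith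
  have hp : 0 ≤ 1 / k := by positivity
  have hq : 0 ≤ 1 - 1 / k := sub_nonneg.2 ((div_le_one hk₀).2 hk)
  have ha : 0 ≤ β * n / k := by positivity
  have hc : 0 ≤ β * n / k + β / (β - 1) :=
    add_nonneg ha (div_nonneg hβ₀.le (by linarith))
  have hε : (Real.exp (β - 1) / β ^ β) ^ ((n : ℝ) / k)
      = β ^ (-(β * n / k)) * Real.exp ((β - 1) * (n * (1 / k))) := by
    rw [Real.div_rpow (Real.exp_pos _).le (by positivity), ← Real.exp_mul, ← Real.rpow_mul hβ₀.le,
      Real.rpow_neg hβ₀.le, div_eq_inv_mul]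
    ring_nf
  set P : ℕ → ℝ := fun t => (n.choose t : ℝ) * (1 / k) ^ t * (1 - 1 / k) ^ (n - t)
  have hP₀ : ∀ t, 0 ≤ P t := fun t => by positivity
  calc ∑ t ∈ (Finset.range (n + 1)).filter (fun t : ℕ => β * n / k < (t : ℝ)), (t : ℝ) * P t
      ≤ ∑ t ∈ (Finset.range (n + 1)).filter (fun t : ℕ => β * n / k < (t : ℝ)),
          β ^ (-(β * n / k)) * (β * n / k + β / (β - 1)) * (β ^ t * P t) := by
        refine Finset.sum_le_sum fun t ht => ?_
        have h := le_rpow_sub_mul_add β _ t hβ ha (Finset.mem_filter.1 ht).2.le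
        rw [sub_eq_add_neg, Real.rpow_add hβ₀, Real.rpow_natCast] at h
        linear_combination mul_le_mul_of_nonneg_right h (hP₀ t)
    _ ≤ ∑ t ∈ Finset.range (n + 1),
          β ^ (-(β * n / k)) * (β * n / k + β / (β - 1)) * (β ^ t * P t) :=
        Finset.sum_le_sum_of_subset_of_nonneg (Finset.filter_subset _ _) fun t _ _ =>
          mul_nonneg (mul_nonneg (by positivity) hc) (mul_nonneg (by positivity) (hP₀ t))
    _ ≤ β ^ (-(β * n / k)) * (β * n / k + β / (β - 1)) *
          Real.exp ((β - 1) * (n * (1 / k))) := by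
        rw [← Finset.mul_sum]
        exact mul_le_mul_of_nonneg_left (sum_pow_mul_binomial_le_exp n (1 / k) β hp hβ.le)
          (mul_nonneg (by positivity) hc)
    _ = (Real.exp (β - 1) / β ^ β) ^ ((n : ℝ) / k) * (β * n / k + β / (β - 1)) := by
        rw [hε]
        ring
    _ ≤ _ := by
        refine mul_le_mul_of_nonneg_left ?_ (by positivity)
        linarith [div_sub_one_le_one_add_div_sub_exp β hβ]
end

section
/- Let d ≥ 2 and let P be a set of n points in ℝ^d in general position, all of whose points are k-shallow in P, where k is an integer with 2 ≤ k ≤ n/256. Let Z be a random subset of P obtained by including each point of P independently with probability 1/k, and let Y ⊆ Z be the set of vertices of the convex hull of Z (the extreme points of Z). Then with probability strictly greater than 0.22 one has simultaneously |Y| ≥ n/(8k) and n/(2k) ≤ |Z| ≤ 2n/k. -/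
open scoped RealInnerProductSpace
open scoped Classical

noncomputable section

/-- A closed halfspace in `ℝ^d`. -/
def halfspace {d : ℕ} (a : EuclideanSpace ℝ (Fin d)) (b : ℝ) : Set (EuclideanSpace ℝ (Fin d)) :=
  {x | ⟪x, a⟫ ≤ b}

/-- A hyperplane in `ℝ^d`. -/
def hyperplane {d : ℕ} (a : EuclideanSpace ℝ (Fin d)) (b : ℝ) : Set (EuclideanSpace ℝ (Fin d)) :=
  {x | ⟪x, a⟫ = b}

/-- A point `p` of a finite set `P` is `k`-shallow if some closed halfspace contains `p`
and at most `k` points of `P`. -/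
def IsShallowPt {d : ℕ} (P : Finset (EuclideanSpace ℝ (Fin d))) (k : ℕ)
    (p : EuclideanSpace ℝ (Fin d)) : Prop :=
  ∃ a b, a ≠ 0 ∧ p ∈ halfspace a b ∧
    ((P : Set (EuclideanSpace ℝ (Fin d))) ∩ halfspace a b).ncard ≤ k

/-- `P` is in general position: no `d+1` points of `P` lie on a common hyperplane. -/
def GenPos {d : ℕ} (P : Finset (EuclideanSpace ℝ (Fin d))) : Prop :=
  ∀ (a : EuclideanSpace ℝ (Fin d)) (b : ℝ), a ≠ 0 →
    ((P : Set (EuclideanSpace ℝ (Fin d))) ∩ hyperplane a b).ncard ≤ d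

/-- The vertices of the convex hull of a finite set `S`: points of `S` not in the
convex hull of the remaining points. -/
def hullVertices {d : ℕ} (S : Finset (EuclideanSpace ℝ (Fin d))) :
    Set (EuclideanSpace ℝ (Fin d)) :=
  {z | z ∈ S ∧ z ∉ convexHull ℝ ((S : Set (EuclideanSpace ℝ (Fin d))) \ {z})}

/-- The probability of `S` under the random subset of a set of size `n` that contains each point
independently with probability `p`. -/
def bernoulliWeight {α : Type*} (p : ℝ) (n : ℕ) (S : Finset α) : ℝ :=
  p ^ S.card * (1 - p) ^ (n - S.card)

lemma bernoulliWeight_nonneg {α : Type*} {p : ℝ} (hp0 : 0 ≤ p) (hp1 : p ≤ 1) (n : ℕ)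
    (S : Finset α) : 0 ≤ bernoulliWeight p n S :=
  mul_nonneg (pow_nonneg hp0 _) (pow_nonneg (sub_nonneg.2 hp1) _)

lemma sum_bernoulliWeight {α : Type*} (p : ℝ) (P : Finset α) :
    ∑ S ∈ P.powerset, bernoulliWeight p P.card S = 1 := by
  simp [bernoulliWeight, Finset.sum_pow_mul_eq_add_pow]

lemma sum_bernoulliWeight_mul_sq_sub {α : Type*} (p : ℝ) (P : Finset α) :
    ∑ S ∈ P.powerset, bernoulliWeight p P.card S * ((S.card : ℝ) - P.card * p) ^ 2
      = P.card * p * (1 - p) := by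
  have h := congrArg (Polynomial.eval p) (bernsteinPolynomial.variance ℝ P.card)
  simp only [bernsteinPolynomial, Polynomial.eval_finsetSum, nsmul_eq_mul, Polynomial.eval_mul,
    Polynomial.eval_pow, Polynomial.eval_sub, Polynomial.eval_natCast, Polynomial.eval_X,
    Polynomial.eval_one] at h
  rw [← h]
  have h2 := Finset.sum_powerset_apply_card
    (fun m => p ^ m * (1 - p) ^ (P.card - m) * ((m : ℝ) - P.card * p) ^ 2) (x := P)
  simp only [bernoulliWeight]
  rw [h2]
  refine Finset.sum_congr rfl fun m _ => ?_
  rw [nsmul_eq_mul]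
  ring

/-- The probability that the random subset contains `x` and avoids `B`. -/
lemma sum_bernoulliWeight_mem_disjoint {α : Type*} [DecidableEq α] (p : ℝ) {P B : Finset α} {x : α}
    (hx : x ∈ P) (hB : B ⊆ P) (hxB : x ∉ B) :
    ∑ S ∈ P.powerset, (if x ∈ S ∧ Disjoint S B then bernoulliWeight p P.card S else 0)
      = p * (1 - p) ^ B.card := by
  have h := Finset.prod_add (fun i => if i ∈ B then 0 else p)
    (fun i => if i = x then 0 else 1 - p) P
  have hl : ∏ i ∈ P, ((if i ∈ B then 0 else p) + (if i = x then 0 else 1 - p))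
      = p * (1 - p) ^ B.card := by
    rw [← Finset.mul_prod_erase P _ hx]
    have hB' : B ⊆ P.erase x := fun y hy =>
      Finset.mem_erase.2 ⟨ne_of_mem_of_not_mem hy hxB, hB hy⟩
    rw [← Finset.prod_subset hB']
    · rw [if_neg hxB, if_pos rfl, add_zero]
      congr 1
      refine Finset.prod_eq_pow_card fun i hi => ?_
      rw [if_pos hi, if_neg (ne_of_mem_of_not_mem hi hxB), zero_add]
    · intro i hi hiB
      rw [if_neg hiB, if_neg (Finset.ne_of_mem_erase hi)]
      ring
  rw [← hl, h]
  refine Finset.sum_congr rfl fun S hS => ?_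
  rw [Finset.mem_powerset] at hS
  split_ifs with hc
  · obtain ⟨hxS, hd⟩ := hc
    rw [Finset.prod_eq_pow_card (b := p), Finset.prod_eq_pow_card (b := 1 - p),
      Finset.card_sdiff_of_subset hS, bernoulliWeight]
    · intro i hi
      exact if_neg (ne_of_mem_of_not_mem hxS (Finset.mem_sdiff.1 hi).2).symm
    · intro i hi
      exact if_neg (Finset.disjoint_left.1 hd hi)
  · rw [not_and_or] at hc
    rcases hc with hc | hc
    · have h0 : ∏ i ∈ P \ S, (if i = x then 0 else 1 - p) = 0 :=
        Finset.prod_eq_zero (Finset.mem_sdiff.2 ⟨hx, hc⟩) (if_pos rfl)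
      rw [h0, mul_zero]
    · obtain ⟨y, hyS, hyB⟩ := Finset.not_disjoint_iff.1 hc
      have h0 : ∏ i ∈ S, (if i ∈ B then 0 else p) = 0 :=
        Finset.prod_eq_zero hyS (if_pos hyB)
      rw [h0, zero_mul]

/-- A `k`-shallow point is a hull vertex of every subset that contains it and avoids a certain set
of fewer than `k` other points. -/
lemma IsShallowPt.exists_card_lt_mem_hullVertices {d : ℕ}
    {P : Finset (EuclideanSpace ℝ (Fin d))} {k : ℕ} {x : EuclideanSpace ℝ (Fin d)}
    (h : IsShallowPt P k x) (hx : x ∈ P) :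
    ∃ B ⊆ P, x ∉ B ∧ B.card < k ∧
      ∀ S ⊆ P, x ∈ S → Disjoint S B → x ∈ hullVertices S := by
  obtain ⟨a, b, -, hxb, hcard⟩ := h
  have hle : (P.filter (fun y => ⟪y, a⟫ ≤ ⟪x, a⟫)).card ≤ k := by
    refine le_trans ?_ hcard
    rw [← Set.ncard_coe_finset]
    refine Set.ncard_le_ncard ?_ (P.finite_toSet.inter_of_left _)
    intro y hy
    obtain ⟨hyP, hya⟩ := Finset.mem_filter.1 (Finset.mem_coe.1 hy)
    exact ⟨hyP, le_trans hya hxb⟩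
  have hxf : x ∈ P.filter (fun y => ⟪y, a⟫ ≤ ⟪x, a⟫) := Finset.mem_filter.2 ⟨hx, le_rfl⟩
  refine ⟨(P.filter (fun y => ⟪y, a⟫ ≤ ⟪x, a⟫)).erase x,
    (Finset.erase_subset _ _).trans (Finset.filter_subset _ _), Finset.notMem_erase _ _,
    (Finset.card_erase_lt_of_mem hxf).trans_le hle, fun S hS hxS hd => ⟨hxS, fun hmem => ?_⟩⟩
  have hconv : Convex ℝ {y : EuclideanSpace ℝ (Fin d) | ⟪x, a⟫ < ⟪y, a⟫} :=
    convex_halfSpace_gt ⟨fun u v => inner_add_left u v a, fun c u => real_inner_smul_left u a c⟩ _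
  refine lt_irrefl ⟪x, a⟫ (convexHull_min ?_ hconv hmem)
  rintro y ⟨hyS, hyx⟩
  by_contra hlt
  exact Finset.disjoint_left.1 hd hyS
    (Finset.mem_erase.2 ⟨hyx, Finset.mem_filter.2 ⟨hS hyS, not_lt.1 hlt⟩⟩)

lemma ncard_hullVertices_le {d : ℕ} (S : Finset (EuclideanSpace ℝ (Fin d))) :
    (hullVertices S).ncard ≤ S.card := by
  rw [← Set.ncard_coe_finset]
  exact Set.ncard_le_ncard (fun _ h => h.1) S.finite_toSet

/-- Lower bound on the expected number of hull vertices of a random subset of a shallow set. -/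
lemma le_sum_bernoulliWeight_mul_ncard_hullVertices {d : ℕ}
    {P : Finset (EuclideanSpace ℝ (Fin d))} {k : ℕ} (hshallow : ∀ x ∈ P, IsShallowPt P k x)
    {p : ℝ} (hp0 : 0 ≤ p) (hp1 : p ≤ 1) :
    P.card * (p * (1 - p) ^ (k - 1)) ≤
      ∑ S ∈ P.powerset, bernoulliWeight p P.card S * (hullVertices S).ncard := by
  choose! B hBP hxB hBk hB using fun x hx =>
    (hshallow x hx).exists_card_lt_mem_hullVertices hx
  calc P.card * (p * (1 - p) ^ (k - 1))
      = ∑ x ∈ P, p * (1 - p) ^ (k - 1) := by rw [Finset.sum_const, nsmul_eq_mul]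
    _ ≤ ∑ x ∈ P, p * (1 - p) ^ (B x).card := by
        refine Finset.sum_le_sum fun x hx => mul_le_mul_of_nonneg_left ?_ hp0
        exact pow_le_pow_of_le_one (by linarith) (by linarith) (Nat.le_sub_one_of_lt (hBk x hx))
    _ = ∑ x ∈ P, ∑ S ∈ P.powerset,
          (if x ∈ S ∧ Disjoint S (B x) then bernoulliWeight p P.card S else 0) :=
        Finset.sum_congr rfl fun x hx =>
          (sum_bernoulliWeight_mem_disjoint p hx (hBP x hx) (hxB x hx)).symm
    _ = ∑ S ∈ P.powerset, bernoulliWeight p P.card S *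
          (P.filter (fun x => x ∈ S ∧ Disjoint S (B x))).card := by
        rw [Finset.sum_comm]
        refine Finset.sum_congr rfl fun S _ => ?_
        rw [← Finset.sum_filter, Finset.sum_const, nsmul_eq_mul, mul_comm]
    _ ≤ _ := by
        refine Finset.sum_le_sum fun S hS => mul_le_mul_of_nonneg_left ?_
          (bernoulliWeight_nonneg hp0 hp1 _ _)
        rw [← Set.ncard_coe_finset]
        refine Nat.cast_le.2 (Set.ncard_le_ncard ?_ (S.finite_toSet.subset fun _ h => h.1))
        intro x hx
        obtain ⟨hxP, hxS, hd⟩ := Finset.mem_filter.1 (Finset.mem_coe.1 hx)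
        exact hB x hxP S (Finset.mem_powerset.1 hS) hxS hd

lemma exp_neg_one_le_one_sub_inv_pow {k : ℕ} (hk : 2 ≤ k) :
    Real.exp (-1) ≤ (1 - 1 / (k : ℝ)) ^ (k - 1) := by
  obtain ⟨m, rfl⟩ : ∃ m, k = m + 1 := ⟨k - 1, by omega⟩
  have hm : (0 : ℝ) < m := by exact_mod_cast (by omega : 0 < m)
  have hexp : Real.exp (-1 / m) ≤ 1 - 1 / ((m + 1 : ℕ) : ℝ) := by
    have h1 := Real.add_one_le_exp (1 / (m : ℝ))
    have h2 : 1 - 1 / ((m + 1 : ℕ) : ℝ) = (1 / (m : ℝ) + 1)⁻¹ := by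
      push_cast
      field_simp
      ring
    rw [h2, neg_div, Real.exp_neg]
    exact inv_anti₀ (by positivity) h1
  calc Real.exp (-1) = Real.exp (-1 / m) ^ m := by
        rw [← Real.exp_nat_mul]
        congr 1
        field_simp
    _ ≤ _ := by
        rw [Nat.add_sub_cancel]
        exact pow_le_pow_left₀ (Real.exp_pos _).le hexp m

/-- The number `y` of hull vertices is bounded by a multiple of the indicator of the event that
both `y` and the sample size `z` are as desired, up to the deviation of `z` from its mean `m`. -/
lemma vertex_count_le_indicator {m y z : ℝ} (hm : 0 < m) (hyz : y ≤ z) :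
    y ≤ m / 8 + 4 / m * (z - m) ^ 2 +
      15 / 16 * m * (if m / 8 ≤ y ∧ m / 2 ≤ z ∧ z ≤ 2 * m then 1 else 0) := by
  obtain ⟨t, rfl⟩ : ∃ t, z = m * (1 + t) := ⟨z / m - 1, by field_simp; ring⟩
  have hsq : 4 / m * (m * (1 + t) - m) ^ 2 = m * (4 * t ^ 2) := by field_simp; ring
  rw [hsq]
  split_ifs with h
  · have := mul_nonneg hm.le (sq_nonneg (2 * t - 1 / 4))
    nlinarith
  · by_cases hy : m / 8 ≤ y
    · have ht : t < -1 / 2 ∨ 1 < t := by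
        by_contra hc
        push Not at hc
        exact h ⟨hy, by nlinarith, by nlinarith⟩
      have hb : 1 + t ≤ 1 / 8 + 4 * t ^ 2 := by rcases ht with ht | ht <;> nlinarith
      nlinarith [mul_le_mul_of_nonneg_left hb hm.le]
    · nlinarith [mul_nonneg hm.le (sq_nonneg t)]

/-- Proposition 2.1: sampling each point of a `k`-shallow set independently
with probability `1/k`, with probability `> 0.22` the sample `Z` satisfies
`|Y| ≥ n/(8k)` and `n/(2k) ≤ |Z| ≤ 2n/k`, where `Y` is the set of hull vertices of `Z`. -/
theorem sample_of_shallow_set_has_many_hull_vertices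
    (d : ℕ) (hd : 2 ≤ d) (P : Finset (EuclideanSpace ℝ (Fin d))) (n k : ℕ)
    (hn : P.card = n) (hk : 2 ≤ k) (hkn : (k : ℝ) ≤ (n : ℝ) / 256)
    (hgp : GenPos P) (hshallow : ∀ p ∈ P, IsShallowPt P k p) :
    (0.22 : ℝ) <
      ∑ S ∈ P.powerset.filter (fun S =>
          ((n : ℝ) / (8 * k) ≤ ((hullVertices S).ncard : ℝ)) ∧
          ((n : ℝ) / (2 * k) ≤ (S.card : ℝ) ∧ (S.card : ℝ) ≤ 2 * n / k)),
        (1 / (k : ℝ)) ^ S.card * (1 - 1 / (k : ℝ)) ^ (P.card - S.card) := by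
  subst hn
  have hk0 : (0 : ℝ) < k := by exact_mod_cast (by omega : 0 < k)
  have hp0 : 0 ≤ 1 / (k : ℝ) := by positivity
  have hp1 : 1 / (k : ℝ) ≤ 1 := by
    rw [div_le_one hk0]
    exact_mod_cast (by omega : 1 ≤ k)
  set p : ℝ := 1 / (k : ℝ) with hp
  set m : ℝ := P.card * p with hmdef
  have hm : 256 ≤ m := by
    rw [hmdef, hp, mul_one_div, le_div_iff₀ hk0]
    linarith
  have hm0 : 0 < m := by linarith
  have e1 : (P.card : ℝ) / (8 * k) = m / 8 := by rw [hmdef, hp]; field_simp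
  have e2 : (P.card : ℝ) / (2 * k) = m / 2 := by rw [hmdef, hp]; field_simp
  have e3 : 2 * (P.card : ℝ) / k = 2 * m := by rw [hmdef, hp]; field_simp
  rw [e1, e2, e3]
  change _ < ∑ S ∈ _, bernoulliWeight p P.card S
  set q := ∑ S ∈ P.powerset.filter (fun S => m / 8 ≤ ((hullVertices S).ncard : ℝ) ∧
    m / 2 ≤ (S.card : ℝ) ∧ (S.card : ℝ) ≤ 2 * m), bernoulliWeight p P.card S with hq
  have hlow := le_sum_bernoulliWeight_mul_ncard_hullVertices hshallow hp0 hp1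
  have hup : ∑ S ∈ P.powerset, bernoulliWeight p P.card S * (hullVertices S).ncard ≤
      m / 8 + 4 / m * (m * (1 - p)) + 15 / 16 * m * q := by
    have hvar := sum_bernoulliWeight_mul_sq_sub p P
    rw [← hmdef] at hvar
    have hone := sum_bernoulliWeight p P
    have hconst : m / 8 = ∑ S ∈ P.powerset, m / 8 * bernoulliWeight p P.card S := by
      rw [← Finset.mul_sum, hone, mul_one]
    rw [← hvar, hq, Finset.sum_filter, Finset.mul_sum, Finset.mul_sum]
    refine le_of_le_of_eq ?_ (congrArg (fun c => c + _ + _) hconst.symm)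
    rw [← Finset.sum_add_distrib, ← Finset.sum_add_distrib]
    refine Finset.sum_le_sum fun S _ => ?_
    have h := mul_le_mul_of_nonneg_left
      (vertex_count_le_indicator hm0 (Nat.cast_le.2 (ncard_hullVertices_le S)))
      (bernoulliWeight_nonneg hp0 hp1 P.card S)
    refine h.trans (le_of_eq ?_)
    split_ifs <;> ring
  have hexp : 0.36 < (1 - p) ^ (k - 1) := by
    refine lt_of_lt_of_le ?_ (exp_neg_one_le_one_sub_inv_pow hk)
    linarith [Real.exp_neg_one_gt_d9]
  have h4 : 4 / m * (m * (1 - p)) ≤ 4 := by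
    have : 4 / m * (m * (1 - p)) = 4 * (1 - p) := by field_simp
    linarith
  have hlow' : m * 0.36 < P.card * (p * (1 - p) ^ (k - 1)) := by
    rw [← mul_assoc]
    exact mul_lt_mul_of_pos_left hexp hm0
  by_contra! hc
  have := mul_le_mul_of_nonneg_left hc hm0.le
  linarith
end
end

section
/- Let c₁ > 0, δ > 0, 0 < q < 1, and let k > 0 and n > 0 be real numbers. Let c₂ be a real number with c₂ ≥ max{2, 8c₁(δ + log₂(1/q))}, and suppose n ≥ 2c₂k. Set p = (c₂k/n)·log₂(n/(c₂k)). Then (4c₁/p)·(δ·log₂(1/p) + log₂(1/q)) ≤ n/(2k). (This is the computation establishing Proposition 2.3: the relative-approximation sample-size bound with ε = 1/2 and this p is at most n/(2k).) -/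
/-- the sample-size computation of Proposition 2.3. -/
theorem relative_approx_sample_size (c₁ δ q k n c₂ : ℝ)
    (hc₁ : 0 < c₁) (hδ : 0 < δ) (hq0 : 0 < q) (hq1 : q < 1)
    (hk : 0 < k) (hn : 0 < n)
    (hc₂ : max 2 (8 * c₁ * (δ + Real.logb 2 (1 / q))) ≤ c₂)
    (hn2 : 2 * c₂ * k ≤ n) :
    (4 * c₁ / ((c₂ * k / n) * Real.logb 2 (n / (c₂ * k)))) *
        (δ * Real.logb 2 (1 / ((c₂ * k / n) * Real.logb 2 (n / (c₂ * k))))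
          + Real.logb 2 (1 / q))
      ≤ n / (2 * k) := by
  have hc₂0 : 0 < c₂ := two_pos.trans_le ((le_max_left _ _).trans hc₂)
  have hc₂Q := (le_max_right _ _).trans hc₂
  have hQ : 0 ≤ Real.logb 2 (1 / q) :=
    Real.logb_nonneg one_lt_two ((one_le_div hq0).2 hq1.le)
  generalize Real.logb 2 (1 / q) = Q at *
  have hx : 2 ≤ n / (c₂ * k) := by
    rw [le_div_iff₀ (by positivity)]
    linarith
  have hinv : c₂ * k / n = (n / (c₂ * k))⁻¹ := (inv_div _ _).symm
  have hrhs : n / (2 * k) = n / (c₂ * k) * c₂ / 2 := by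
    field_simp
  rw [hinv, hrhs]
  generalize n / (c₂ * k) = x at *
  have hx0 : 0 < x := by linarith
  have hL : 1 ≤ Real.logb 2 x := by
    rw [Real.le_logb_iff_rpow_le one_lt_two hx0]
    simpa using hx
  have hlog : Real.logb 2 (1 / (x⁻¹ * Real.logb 2 x)) ≤ Real.logb 2 x := by
    apply Real.logb_le_logb_of_le one_lt_two (by positivity)
    rw [div_le_iff₀ (by positivity)]
    field_simp
    exact hL
  generalize Real.logb 2 x = L at *
  have hL0 : 0 < L := by linarith
  calc 4 * c₁ / (x⁻¹ * L) * (δ * Real.logb 2 (1 / (x⁻¹ * L)) + Q)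
      ≤ 4 * c₁ / (x⁻¹ * L) * (δ * L + Q * L) := by
        gcongr
        exact le_mul_of_one_le_right hQ hL
    _ = x * (8 * c₁ * (δ + Q)) / 2 := by
        field_simp
        ring
    _ ≤ x * c₂ / 2 := by gcongr
end

section
/- For every integer j ≥ 1 there exists a constant C = C(j) such that the following holds. Let n ≥ 1 be an integer and p ∈ (0,1] a real with μ = np ≥ 2, and let X be a binomial random variable with parameters n and p. Then E[X^j · log₂(X+1)] ≤ C · μ^j · log₂ μ. -/
/-- The moment generating function of a binomial variable of mean `μ = n * p ≥ 1`,
evaluated at `μ⁻¹`, is at most `exp 2`. -/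
lemma sum_binomial_mul_exp_div_mean_le {n : ℕ} {p : ℝ} (hp : 0 ≤ p) (hp' : p ≤ 1)
    (hμ : 1 ≤ (n : ℝ) * p) :
    ∑ t ∈ Finset.range (n + 1),
        ((n.choose t : ℝ) * p ^ t * (1 - p) ^ (n - t)) * Real.exp ((t : ℝ) / (n * p)) ≤
      Real.exp 2 := by
  set μ : ℝ := n * p with hμ_def
  have hμ_pos : 0 < μ := by linarith
  have h_exp : Real.exp μ⁻¹ - 1 ≤ 2 * μ⁻¹ := by
    have h_inv : |μ⁻¹| = μ⁻¹ := abs_of_pos (by positivity)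
    have h := Real.abs_exp_sub_one_le (x := μ⁻¹) (h_inv.le.trans (inv_le_one_of_one_le₀ hμ))
    rw [h_inv] at h
    exact (le_abs_self _).trans h
  calc _ = (p * Real.exp μ⁻¹ + (1 - p)) ^ n := by
        rw [add_pow]
        refine Finset.sum_congr rfl fun t _ => ?_
        rw [div_eq_mul_inv, Real.exp_nat_mul, mul_pow]
        ring
    _ ≤ Real.exp (2 * p * μ⁻¹) ^ n := by
        have h_nonneg : 0 ≤ 1 - p := by linarith
        refine pow_le_pow_left₀ (by positivity) ?_ n
        have h₁ := Real.add_one_le_exp (2 * p * μ⁻¹)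
        have h₂ := mul_le_mul_of_nonneg_left h_exp hp
        linarith
    _ = Real.exp 2 := by
        rw [← Real.exp_nat_mul]
        congr 1
        rw [show (n : ℝ) * (2 * p * μ⁻¹) = 2 * (μ * μ⁻¹) by rw [hμ_def]; ring,
          mul_inv_cancel₀ hμ_pos.ne', mul_one]

lemma Real.logb_two_le_two_mul {y : ℝ} (hy : 0 < y) : Real.logb 2 y ≤ 2 * y := by
  have h₁ := Real.log_two_gt_d9
  have h₂ := Real.log_le_sub_one_of_pos hy
  rw [Real.logb, div_le_iff₀ (by linarith)]
  nlinarith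

lemma pow_mul_logb_add_one_le (j : ℕ) {t μ : ℝ} (ht : 0 ≤ t) (hμ : 2 ≤ μ) :
    t ^ j * Real.logb 2 (t + 1) ≤
      (3 * (j.factorial : ℝ) + 2 * ((j + 1).factorial : ℝ)) * μ ^ j * Real.logb 2 μ *
        Real.exp (t / μ) := by
  have hμ_pos : 0 < μ := by linarith
  set x := t / μ with hx_def
  have hx : 0 ≤ x := by positivity
  have ht_eq : t = μ * x := by rw [hx_def]; field_simp
  have hL : 1 ≤ Real.logb 2 μ := by
    rw [Real.le_logb_iff_rpow_le (by norm_num) hμ_pos]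
    simpa using hμ
  have h_log : Real.logb 2 (t + 1) ≤ Real.logb 2 μ * (3 + 2 * x) := by
    have h_inv : μ⁻¹ ≤ 1 / 2 := by
      rw [one_div]
      exact inv_anti₀ (by norm_num) hμ
    have hy : 0 < x + μ⁻¹ := by positivity
    have h_eq : t + 1 = μ * (x + μ⁻¹) := by
      rw [mul_add, ← ht_eq, mul_inv_cancel₀ hμ_pos.ne']
    rw [h_eq, Real.logb_mul hμ_pos.ne' hy.ne']
    have := Real.logb_two_le_two_mul hy
    nlinarith
  have h_pow (k : ℕ) : x ^ k ≤ k.factorial * Real.exp x := by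
    have := Real.pow_div_factorial_le_exp x hx k
    rwa [div_le_iff₀' (by positivity)] at this
  calc t ^ j * Real.logb 2 (t + 1) ≤ t ^ j * (Real.logb 2 μ * (3 + 2 * x)) := by gcongr
    _ = μ ^ j * Real.logb 2 μ * (3 * x ^ j + 2 * x ^ (j + 1)) := by
        rw [ht_eq, mul_pow]
        ring
    _ ≤ μ ^ j * Real.logb 2 μ *
          (3 * (j.factorial * Real.exp x) + 2 * ((j + 1).factorial * Real.exp x)) := by
        gcongr
        · exact h_pow j
        · exact h_pow (j + 1)
    _ = _ := by ring

/-- Lemma 3.3(i): `E[X^j · log₂(X+1)] = O(μ^j · log₂ μ)` for a binomial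
random variable `X` with parameters `n` and `p`, where `μ = np ≥ 2`. -/
theorem binomial_moment_log_bound (j : ℕ) (hj : 1 ≤ j) :
    ∃ C : ℝ, 0 < C ∧
      ∀ (n : ℕ), 1 ≤ n → ∀ p : ℝ, 0 < p → p ≤ 1 → 2 ≤ (n : ℝ) * p →
        ∑ t ∈ Finset.range (n + 1),
            ((n.choose t : ℝ) * p ^ t * (1 - p) ^ (n - t)) *
              ((t : ℝ) ^ j * Real.logb 2 ((t : ℝ) + 1))
          ≤ C * ((n : ℝ) * p) ^ j * Real.logb 2 ((n : ℝ) * p) := by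
  set K : ℝ := 3 * (j.factorial : ℝ) + 2 * ((j + 1).factorial : ℝ)
  refine ⟨K * Real.exp 2, by positivity, fun n _ p hp hp' hμ => ?_⟩
  have h_nonneg : 0 ≤ 1 - p := by linarith
  have hL : 0 ≤ Real.logb 2 ((n : ℝ) * p) := Real.logb_nonneg (by norm_num) (by linarith)
  calc _ ≤ ∑ t ∈ Finset.range (n + 1),
          ((n.choose t : ℝ) * p ^ t * (1 - p) ^ (n - t)) *
            (K * ((n : ℝ) * p) ^ j * Real.logb 2 ((n : ℝ) * p) *
              Real.exp ((t : ℝ) / (n * p))) :=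
        Finset.sum_le_sum fun t _ => mul_le_mul_of_nonneg_left
          (pow_mul_logb_add_one_le j t.cast_nonneg hμ) (by positivity)
    _ = K * ((n : ℝ) * p) ^ j * Real.logb 2 ((n : ℝ) * p) *
          ∑ t ∈ Finset.range (n + 1),
            ((n.choose t : ℝ) * p ^ t * (1 - p) ^ (n - t)) * Real.exp ((t : ℝ) / (n * p)) := by
        rw [Finset.mul_sum]
        exact Finset.sum_congr rfl fun t _ => by ring
    _ ≤ K * ((n : ℝ) * p) ^ j * Real.logb 2 ((n : ℝ) * p) * Real.exp 2 := by
        gcongr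
        exact sum_binomial_mul_exp_div_mean_le hp.le hp' (by linarith)
    _ = _ := by ring
end

section
/- For every integer d ≥ 3 there is a constant C = C(d) with the following property (Test-set Lemma). Let P be a set of n points in ℝ^d in general position and let k be an integer with 1 ≤ k ≤ n. Then there exists a finite set Q of at most C · (n/k)^{d/(d−1)} hyperplanes in ℝ^d such that for every partition of P into classes P₁, …, P_m with |P_i| ≥ k for every i, together with open d-simplices Δ₁, …, Δ_m with P_i ⊆ Δ_i for every i, the following holds: if κ₀ is a number such that every hyperplane of Q intersects at most κ₀ of the simplices Δ₁, …, Δ_m, then every hyperplane in ℝ^d intersects at most (d+1)·κ₀ + C · (n/k)^{1−1/(d−1)} of the simplices Δ₁, …, Δ_m. -/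
open scoped RealInnerProductSpace
open scoped Classical

noncomputable section

/-- An open `d`-simplex: the interior of the convex hull of `d+1` affinely
independent points. -/
def IsOpenSimplex {d : ℕ} (Δ : Set (EuclideanSpace ℝ (Fin d))) : Prop :=
  ∃ v : Fin (d + 1) → EuclideanSpace ℝ (Fin d),
    AffineIndependent ℝ v ∧ Δ = interior (convexHull ℝ (Set.range v))

section Sampling

variable {ι : Type*}

/-- The probability that a Bernoulli sample of `N` with parameter `p` equals `S`. -/
def sampleWeight (p : ℝ) (N S : Finset ι) : ℝ := p ^ S.card * (1 - p) ^ (N \ S).card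

lemma sampleWeight_nonneg {p : ℝ} (h0 : 0 ≤ p) (h1 : p ≤ 1) (N S : Finset ι) :
    0 ≤ sampleWeight p N S :=
  mul_nonneg (pow_nonneg h0 _) (pow_nonneg (by linarith) _)

lemma sum_sampleWeight_of_subset_of_disjoint (p : ℝ) {N D K : Finset ι} (hD : D ⊆ N) (hK : K ⊆ N)
    (hDK : Disjoint D K) :
    ∑ S ∈ N.powerset with D ⊆ S ∧ Disjoint S K, sampleWeight p N S =
      p ^ D.card * (1 - p) ^ K.card := by
  have key := Finset.prod_add (fun i => if i ∈ K then (0 : ℝ) else p)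
    (fun i => if i ∈ D then (0 : ℝ) else 1 - p) N
  have hl : ∏ i ∈ N, ((if i ∈ K then (0 : ℝ) else p) + (if i ∈ D then (0 : ℝ) else 1 - p)) =
      p ^ D.card * (1 - p) ^ K.card := by
    have : ∀ i ∈ N, ((if i ∈ K then (0 : ℝ) else p) + (if i ∈ D then (0 : ℝ) else 1 - p)) =
        (if i ∈ D then p else 1) * (if i ∈ K then 1 - p else 1) := by
      intro i _
      by_cases h1 : i ∈ D
      · have h2 : i ∉ K := Finset.disjoint_left.1 hDK h1
        simp [h1, h2]
      · by_cases h2 : i ∈ K <;> simp [h1, h2]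
    rw [Finset.prod_congr rfl this, Finset.prod_mul_distrib, Finset.prod_ite_mem,
      Finset.prod_ite_mem, Finset.inter_eq_right.2 hD, Finset.inter_eq_right.2 hK]
    simp
  rw [← hl, key, Finset.sum_filter]
  refine Finset.sum_congr rfl fun S hS => ?_
  have hSN : S ⊆ N := Finset.mem_powerset.1 hS
  split_ifs with h
  · rw [Finset.prod_congr (s₁ := S) rfl (g := fun _ => p),
      Finset.prod_congr (s₁ := N \ S) rfl (g := fun _ => 1 - p)]
    · simp [sampleWeight]
    · intro i hi
      rw [if_neg]
      intro hiD
      exact (Finset.mem_sdiff.1 hi).2 (h.1 hiD)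
    · intro i hi
      rw [if_neg (Finset.disjoint_left.1 h.2 hi)]
  · symm
    rw [not_and_or] at h
    rcases h with h | h
    · obtain ⟨i, hi, hiS⟩ := Finset.not_subset.1 h
      rw [Finset.prod_eq_zero (i := i) (s := N \ S), mul_zero]
      · exact Finset.mem_sdiff.2 ⟨hD hi, hiS⟩
      · simp [hi]
    · obtain ⟨i, hi, hiK⟩ := Finset.not_disjoint_iff.1 h
      rw [Finset.prod_eq_zero (i := i) (s := S), zero_mul]
      · exact hi
      · simp [hiK]

lemma sum_sampleWeight_of_subset (p : ℝ) {N D : Finset ι} (hD : D ⊆ N) :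
    ∑ S ∈ N.powerset with D ⊆ S, sampleWeight p N S = p ^ D.card := by
  simpa using sum_sampleWeight_of_subset_of_disjoint p hD (Finset.empty_subset N)
    (Finset.disjoint_empty_right D)

lemma sum_sampleWeight (p : ℝ) (N : Finset ι) :
    ∑ S ∈ N.powerset, sampleWeight p N S = 1 := by
  simpa using sum_sampleWeight_of_subset p (Finset.empty_subset N)

lemma exists_of_sum_sampleWeight_le {p : ℝ} (h0 : 0 ≤ p) (h1 : p ≤ 1) {N : Finset ι}
    {F : Finset ι → ℝ} {c : ℝ} (h : ∑ S ∈ N.powerset, sampleWeight p N S * F S ≤ c) :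
    ∃ S ⊆ N, F S ≤ c := by
  by_contra! hcon
  have h2 : ∑ S ∈ N.powerset, sampleWeight p N S * c <
      ∑ S ∈ N.powerset, sampleWeight p N S * F S := by
    have hpos : ∃ S ∈ N.powerset, 0 < sampleWeight p N S := by
      by_contra! hc
      have := Finset.sum_nonpos hc
      rw [sum_sampleWeight] at this
      linarith
    obtain ⟨S, hS, hpS⟩ := hpos
    refine Finset.sum_lt_sum (fun T hT => ?_) ⟨S, hS, ?_⟩
    · exact mul_le_mul_of_nonneg_left (hcon T (Finset.mem_powerset.1 hT)).le
        (sampleWeight_nonneg h0 h1 _ _)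
    · exact mul_lt_mul_of_pos_left (hcon S (Finset.mem_powerset.1 hS)) hpS
  rw [← Finset.sum_mul, sum_sampleWeight] at h2
  linarith

lemma sum_pow_card_image_le [Fintype ι] {p : ℝ} (h0 : 0 ≤ p) (N : Finset ι) (b : ℕ) :
    ∑ Y : Fin b → ι, p ^ (Finset.univ.image Y ∩ N).card ≤
      (b + (Nᶜ.card : ℝ) + p * N.card) ^ b := by
  induction b with
  | zero => simp
  | succ b ih =>
    have e : ∑ Y : Fin (b + 1) → ι, p ^ (Finset.univ.image Y ∩ N).card =
        ∑ Y : Fin b → ι, ∑ y : ι, p ^ ((insert y (Finset.univ.image Y)) ∩ N).card := by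
      rw [← (Fin.consEquiv (fun _ : Fin (b + 1) => ι)).sum_comp, Fintype.sum_prod_type,
        Finset.sum_comm]
      refine Finset.sum_congr rfl fun Y _ => Finset.sum_congr rfl fun y _ => ?_
      congr 3
      ext z
      simp [Fin.consEquiv, Fin.exists_fin_succ, eq_comm]
    have step : ∀ Y : Fin b → ι, ∑ y : ι, p ^ ((insert y (Finset.univ.image Y)) ∩ N).card ≤
        p ^ (Finset.univ.image Y ∩ N).card * (b + (Nᶜ.card : ℝ) + p * N.card) := by
      intro Y
      set I := Finset.univ.image Y with hI
      have hIb : (I.card : ℝ) ≤ b := by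
        exact_mod_cast Finset.card_image_le.trans (by simp)
      have hterm : ∀ y : ι, p ^ ((insert y I) ∩ N).card ≤ p ^ (I ∩ N).card *
          ((if y ∈ I then 1 else 0) + (if y ∈ Nᶜ then 1 else 0) + (if y ∈ N then p else 0)) := by
        intro y
        have hp := pow_nonneg h0 (I ∩ N).card
        by_cases hyI : y ∈ I
        · rw [Finset.insert_eq_of_mem hyI, if_pos hyI]
          refine le_mul_of_one_le_right hp ?_
          have : (0 : ℝ) ≤ (if y ∈ Nᶜ then 1 else 0) + (if y ∈ N then p else 0) := by positivity
          linarith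
        · by_cases hyN : y ∈ N
          · rw [Finset.insert_inter_of_mem hyN, Finset.card_insert_of_notMem (by simp [hyI])]
            simp [hyI, hyN, pow_succ]
          · rw [Finset.insert_inter_of_notMem hyN]
            simp [hyI, hyN]
      refine (Finset.sum_le_sum fun y _ => hterm y).trans ?_
      rw [← Finset.mul_sum]
      refine mul_le_mul_of_nonneg_left ?_ (pow_nonneg h0 _)
      rw [Finset.sum_add_distrib, Finset.sum_add_distrib]
      simp only [Finset.sum_ite_mem, Finset.univ_inter, Finset.sum_const, nsmul_eq_mul, mul_one]
      linarith
    rw [e]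
    refine (Finset.sum_le_sum fun Y _ => step Y).trans ?_
    rw [← Finset.sum_mul, pow_succ]
    have hx : (0 : ℝ) ≤ b + (Nᶜ.card : ℝ) + p * N.card := by positivity
    push_cast
    refine mul_le_mul (ih.trans ?_) (by linarith) hx (by positivity)
    exact pow_le_pow_left₀ hx (by linarith) _

lemma sum_sampleWeight_mul_card_pow_le [Fintype ι] {p : ℝ} (h0 : 0 ≤ p)
    (N : Finset ι) (b : ℕ) :
    ∑ S ∈ N.powerset, sampleWeight p N S * ((S.card : ℝ) + Nᶜ.card) ^ b ≤
      (b + (Nᶜ.card : ℝ) + p * N.card) ^ b := by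
  refine le_trans (le_of_eq ?_) (sum_pow_card_image_le h0 N b)
  have h3 : ∀ S ∈ N.powerset, ((S.card : ℝ) + Nᶜ.card) ^ b =
      ∑ Y : Fin b → ι, if Finset.univ.image Y ∩ N ⊆ S then 1 else 0 := by
    intro S hS
    have hSN := Finset.mem_powerset.1 hS
    rw [Finset.sum_boole]
    have : (Finset.univ.filter fun Y : Fin b → ι => Finset.univ.image Y ∩ N ⊆ S) =
        Fintype.piFinset fun _ => S ∪ Nᶜ := by
      ext Y
      simp only [Finset.mem_filter, Finset.mem_univ, true_and, Fintype.mem_piFinset,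
        Finset.mem_union, Finset.mem_compl, Finset.subset_iff, Finset.mem_inter, Finset.mem_image]
      constructor
      · intro h i
        by_cases hi : Y i ∈ N
        · exact Or.inl (h ⟨⟨i, rfl⟩, hi⟩)
        · exact Or.inr hi
      · rintro h _ ⟨⟨i, rfl⟩, hi⟩
        exact (h i).resolve_right (by simpa using hi)
    rw [this, Fintype.card_piFinset, Finset.prod_const, Finset.card_union_of_disjoint]
    · simp
    · exact Finset.disjoint_left.2 fun x hx hx' => Finset.mem_compl.1 hx' (hSN hx)
  rw [Finset.sum_congr rfl fun S hS => by rw [h3 S hS, Finset.mul_sum], Finset.sum_comm]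
  refine Finset.sum_congr rfl fun Y _ => ?_
  rw [← sum_sampleWeight_of_subset p (Finset.inter_subset_right : Finset.univ.image Y ∩ N ⊆ N),
    Finset.sum_filter]
  exact Finset.sum_congr rfl fun S _ => by simp

lemma exists_sample_of_forall_disjoint (b a : ℕ) :
    ∃ α : ℝ, 1 ≤ α ∧ ∀ {ι : Type*} [Fintype ι] (N : Finset ι), Nᶜ.card = a →
      ∀ K : (Fin b → ι) → Finset ι, (∀ Y, K Y ⊆ N) → ∀ m : ℝ, 0 < m →
        ∃ S ⊆ N, (S.card : ℝ) ≤ α * (1 + N.card / m) ^ 2 ∧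
          ∀ Y, (∀ i, Y i ∈ N → Y i ∈ S) → (∀ z ∈ S, z ∉ K Y) → ((K Y).card : ℝ) ≤ m := by
  obtain ⟨α, hα1, hα⟩ : ∃ α : ℝ, 1 ≤ α ∧ ∀ x, α ≤ x →
      (b + a + x ^ 2) ^ b * Real.exp (-x) ≤ 1 / 4 := by
    have h1 : Filter.Tendsto (fun x : ℝ => (b + a + 1 : ℝ) ^ b * (x ^ (2 * b) * Real.exp (-x)))
        Filter.atTop (nhds 0) := by
      simpa using (Real.tendsto_pow_mul_exp_neg_atTop_nhds_zero (2 * b)).const_mul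
        ((b + a + 1 : ℝ) ^ b)
    have h2 := (h1.eventually_le_const (show (0 : ℝ) < 1 / 4 by norm_num)).and
      (Filter.eventually_ge_atTop 1)
    obtain ⟨α, hα⟩ := Filter.eventually_atTop.1 h2
    refine ⟨max α 1, le_max_right _ _, fun x hx => ?_⟩
    obtain ⟨h3, h4⟩ := hα x ((le_max_left _ _).trans hx)
    refine le_trans ?_ h3
    rw [← mul_assoc, pow_mul, ← mul_pow]
    gcongr
    have h5 : 1 ≤ x ^ 2 := one_le_pow₀ h4
    have h6 : (0 : ℝ) ≤ b + a := by positivity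
    nlinarith
  refine ⟨4 * (1 + a) * α, by nlinarith [(Nat.cast_nonneg a : (0 : ℝ) ≤ a)], ?_⟩
  intro ι _ N hN K hK m hm
  set e : ℝ := 1 + N.card / m with he
  have he1 : 1 ≤ e := by
    have : (0 : ℝ) ≤ N.card / m := by positivity
    linarith
  have hα0 : 0 < α := by linarith
  set s : ℝ := α * e ^ 2 with hs
  have hs1 : 1 ≤ s := one_le_mul_of_one_le_of_one_le hα1 (one_le_pow₀ he1)
  rcases le_or_gt (N.card : ℝ) s with hw | hw
  · refine ⟨N, subset_rfl, hw.trans ?_, fun Y _ hd => ?_⟩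
    · rw [hs]
      gcongr
      nlinarith [(Nat.cast_nonneg a : (0 : ℝ) ≤ a)]
    have : K Y = ∅ := by
      rw [← Finset.disjoint_self_iff_empty]
      exact Finset.disjoint_left.2 fun z hz => hd z (hK Y hz)
    simp [this, hm.le]
  have hw0 : (0 : ℝ) < N.card := by linarith
  set p : ℝ := s / N.card with hp
  have hp0 : 0 ≤ p := by positivity
  have hp1 : p ≤ 1 := (div_le_one hw0).2 hw.le
  have hpN : p * N.card = s := div_mul_cancel₀ _ hw0.ne'
  have hpm : α * e ≤ p * m := by
    rw [hp, div_mul_eq_mul_div, le_div_iff₀ hw0, hs]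
    have : e * m = m + N.card := by
      rw [he]
      field_simp
    nlinarith [mul_pos hα0 (lt_of_lt_of_le one_pos he1)]
  let F : Finset ι → ℝ := fun S =>
    (∑ Y : Fin b → ι, if m < (K Y).card ∧ Finset.univ.image Y ∩ N ⊆ S ∧ Disjoint S (K Y)
      then (1 : ℝ) else 0) + ((S.card : ℝ) + Nᶜ.card) ^ 1 * (1 / (8 * s * (1 + a)))
  have hbad : ∑ S ∈ N.powerset, sampleWeight p N S * (∑ Y : Fin b → ι,
      if m < (K Y).card ∧ Finset.univ.image Y ∩ N ⊆ S ∧ Disjoint S (K Y) then (1 : ℝ) else 0) ≤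
      1 / 4 := by
    have hY : ∀ Y : Fin b → ι, (∑ S ∈ N.powerset, sampleWeight p N S *
        if m < (K Y).card ∧ Finset.univ.image Y ∩ N ⊆ S ∧ Disjoint S (K Y) then (1 : ℝ) else 0) ≤
        p ^ (Finset.univ.image Y ∩ N).card * Real.exp (-(p * m)) := by
      intro Y
      have hnn : 0 ≤ p ^ (Finset.univ.image Y ∩ N).card * Real.exp (-(p * m)) := by positivity
      by_cases hd : Disjoint (Finset.univ.image Y ∩ N) (K Y)
      · by_cases hmK : m < (K Y).card
        · have := sum_sampleWeight_of_subset_of_disjoint p Finset.inter_subset_right (hK Y) hd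
          simp only [hmK, true_and, mul_ite, mul_one, mul_zero]
          rw [← Finset.sum_filter, this]
          refine mul_le_mul_of_nonneg_left ?_ (pow_nonneg hp0 _)
          calc (1 - p) ^ (K Y).card ≤ Real.exp (-p) ^ (K Y).card :=
                pow_le_pow_left₀ (by linarith) (Real.one_sub_le_exp_neg p) _
            _ = Real.exp (-(p * (K Y).card)) := by
                rw [← Real.exp_nat_mul]
                ring_nf
            _ ≤ _ := Real.exp_le_exp.2 (by nlinarith)
        · simpa [hmK] using hnn
      · rw [Finset.sum_eq_zero]
        · exact hnn
        · intro S _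
          rw [if_neg, mul_zero]
          rintro ⟨-, h2, h3⟩
          exact hd (h3.mono_left h2)
    simp_rw [Finset.mul_sum]
    rw [Finset.sum_comm]
    refine (Finset.sum_le_sum fun Y _ => hY Y).trans ?_
    rw [← Finset.sum_mul]
    have hM := sum_pow_card_image_le hp0 N b
    rw [hN, hpN] at hM
    refine le_trans ?_ (hα (α * e) (le_mul_of_one_le_right hα0.le he1))
    refine mul_le_mul (hM.trans ?_) (Real.exp_le_exp.2 (by linarith)) (Real.exp_pos _).le
      (by positivity)
    have : s ≤ (α * e) ^ 2 := by
      rw [hs, mul_pow]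
      have : α ≤ α ^ 2 := by nlinarith
      gcongr
    gcongr
  have hsize : ∑ S ∈ N.powerset, sampleWeight p N S *
      (((S.card : ℝ) + Nᶜ.card) ^ 1 * (1 / (8 * s * (1 + a)))) ≤ 1 / 4 := by
    simp_rw [← mul_assoc]
    rw [← Finset.sum_mul]
    have h1 := sum_sampleWeight_mul_card_pow_le hp0 N 1
    rw [hN, hpN] at h1
    rw [hN, mul_one_div, div_le_iff₀ (by positivity)]
    refine h1.trans ?_
    push_cast
    nlinarith [(Nat.cast_nonneg a : (0 : ℝ) ≤ a), mul_nonneg (Nat.cast_nonneg a : (0 : ℝ) ≤ a)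
      (by linarith : (0 : ℝ) ≤ s - 1)]
  obtain ⟨S, hSN, hS⟩ := exists_of_sum_sampleWeight_le (F := F) (c := 1 / 2) hp0 hp1 (N := N) (by
    simp only [F, fun S : Finset ι => mul_add (sampleWeight p N S)]
    rw [Finset.sum_add_distrib]
    linarith)
  have hc0 : (0 : ℝ) < 8 * s * (1 + a) := by positivity
  have hpos1 : (0 : ℝ) ≤ ∑ Y : Fin b → ι,
      if m < (K Y).card ∧ Finset.univ.image Y ∩ N ⊆ S ∧ Disjoint S (K Y) then (1 : ℝ) else 0 :=
    Finset.sum_nonneg fun Y _ => by positivity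
  have hpos2 : (0 : ℝ) ≤ ((S.card : ℝ) + Nᶜ.card) ^ 1 * (1 / (8 * s * (1 + a))) := by positivity
  simp only [F] at hS
  refine ⟨S, hSN, ?_, fun Y hY1' hY2' => ?_⟩
  · have h1 : ((S.card : ℝ) + Nᶜ.card) ^ 1 * (1 / (8 * s * (1 + a))) ≤ 1 / 2 := by linarith
    rw [mul_one_div, div_le_iff₀ hc0, pow_one] at h1
    have : (0 : ℝ) ≤ Nᶜ.card := Nat.cast_nonneg _
    calc (S.card : ℝ) ≤ 1 / 2 * (8 * s * (1 + a)) := by linarith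
      _ = 4 * (1 + a) * α * e ^ 2 := by
        rw [hs]
        ring
  · by_contra! hcon
    have hY1 : Finset.univ.image Y ∩ N ⊆ S := by
      intro z hz
      obtain ⟨hz1, hz2⟩ := Finset.mem_inter.1 hz
      obtain ⟨i, -, rfl⟩ := Finset.mem_image.1 hz1
      exact hY1' i hz2
    have hY2 : Disjoint S (K Y) := Finset.disjoint_left.2 hY2'
    have h1 := Finset.single_le_sum (f := fun Y : Fin b → ι =>
      if m < (K Y).card ∧ Finset.univ.image Y ∩ N ⊆ S ∧ Disjoint S (K Y) then (1 : ℝ) else 0)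
      (fun Y _ => by positivity) (Finset.mem_univ Y)
    simp only [hcon, hY1, hY2, and_self, if_true] at h1
    linarith

end Sampling

section Cones

variable {V κ : Type*} [AddCommGroup V] [Module ℝ V]

/-- The face of the cone `{g | ∀ i, 0 ≤ ψ i g}` on which the constraints in `S` are tight. -/
def coneFace (ψ : κ → Module.Dual ℝ V) (S : Set κ) : Set V :=
  {g | (∀ i, 0 ≤ ψ i g) ∧ ∀ i ∈ S, ψ i g = 0}

/-- The constraints vanishing at `g` determine `g` up to a scalar. -/
def IsConstraintRay (ψ : κ → Module.Dual ℝ V) (g : V) : Prop :=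
  g ≠ 0 ∧ ∀ w, (∀ i, ψ i g = 0 → ψ i w = 0) → ∃ c : ℝ, w = c • g

lemma exists_max_sub_smul_nonneg [Finite κ] {ψ : κ → Module.Dual ℝ V} {h g : V}
    (hh : ∀ i, 0 ≤ ψ i h) (hg : ∃ i, 0 < ψ i g) :
    ∃ t : ℝ, 0 ≤ t ∧ (∀ i, 0 ≤ ψ i (h - t • g)) ∧ ∃ i, 0 < ψ i g ∧ ψ i (h - t • g) = 0 := by
  obtain ⟨i₀, h0, hmin⟩ := Set.exists_min_image {i | 0 < ψ i g} (fun i => ψ i h / ψ i g)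
    (Set.toFinite _) hg
  have h0' : 0 < ψ i₀ g := h0
  have ht : 0 ≤ ψ i₀ h / ψ i₀ g := div_nonneg (hh _) h0'.le
  refine ⟨ψ i₀ h / ψ i₀ g, ht, fun i => ?_, i₀, h0', ?_⟩
  · simp only [map_sub, map_smul, smul_eq_mul]
    rcases le_or_gt (ψ i g) 0 with hi | hi
    · nlinarith [hh i, mul_nonneg ht (neg_nonneg.2 hi)]
    · have := (le_div_iff₀ hi).1 (hmin i hi)
      linarith
  · simp only [map_sub, map_smul, smul_eq_mul]
    field_simp
    ring

lemma exists_constraintRay [Finite κ] {ψ : κ → Module.Dual ℝ V}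
    (hψ : ∀ g, (∀ i, ψ i g = 0) → g = 0) {h : V} (hh : ∀ i, 0 ≤ ψ i h) (h0 : h ≠ 0) :
    ∃ g, (∀ i, 0 ≤ ψ i g) ∧ IsConstraintRay ψ g ∧ ∀ i, ψ i h = 0 → ψ i g = 0 := by
  obtain ⟨Z, ⟨g, hgC, hg0, hgh, hgZ⟩, hmax⟩ := Set.exists_max_image
    {Z : Set κ | ∃ g, (∀ i, 0 ≤ ψ i g) ∧ g ≠ 0 ∧ (∀ i, ψ i h = 0 → ψ i g = 0) ∧
      {i | ψ i g = 0} = Z} (fun Z => Z.ncard) (Set.toFinite _) ⟨_, h, hh, h0, fun _ hi => hi, rfl⟩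
  refine ⟨g, hgC, ⟨hg0, fun w hw => ?_⟩, hgh⟩
  by_contra! hcon
  obtain ⟨w', hw', hcon', hpos⟩ : ∃ w', (∀ i, ψ i g = 0 → ψ i w' = 0) ∧ (∀ c : ℝ, w' ≠ c • g) ∧
      ∃ i, 0 < ψ i w' := by
    have hw0 : w ≠ 0 := by simpa using hcon 0
    have : ∃ i, ψ i w ≠ 0 := by
      by_contra! hc
      exact hw0 (hψ w hc)
    obtain ⟨i, hi⟩ := this
    rcases lt_or_gt_of_ne hi with hi | hi
    · refine ⟨-w, fun j hj => by simp [hw j hj], fun c hc => hcon (-c) ?_, i, by simpa using hi⟩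
      rw [neg_smul, ← hc, neg_neg]
    · exact ⟨w, hw, hcon, i, hi⟩
  obtain ⟨t, ht, hnn, i, hi, hi0⟩ := exists_max_sub_smul_nonneg hgC hpos
  have hne : g - t • w' ≠ 0 := by
    intro hc
    have hg : g = t • w' := sub_eq_zero.1 hc
    have ht0 : t ≠ 0 := by
      rintro rfl
      exact hg0 (by simpa using hg)
    apply hcon' t⁻¹
    rw [hg, smul_smul, inv_mul_cancel₀ ht0, one_smul]
  have hsub : ∀ j, ψ j g = 0 → ψ j (g - t • w') = 0 := fun j hj => by
    simp [hj, hw' j hj]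
  have h1 := hmax {j | ψ j (g - t • w') = 0}
    ⟨_, hnn, hne, fun j hj => hsub j (hgh j hj), rfl⟩
  have h2 : Z ⊂ {j | ψ j (g - t • w') = 0} := by
    rw [← hgZ]
    refine ⟨fun j hj => hsub j hj, fun hc => ?_⟩
    have : ψ i g = 0 := hc hi0
    have := hw' i this
    linarith
  exact absurd (Set.ncard_lt_ncard h2 (Set.toFinite _)) (not_lt.2 h1)

lemma exists_peeling [Finite κ] [FiniteDimensional ℝ V] {ψ : κ → Module.Dual ℝ V}
    (hψ : ∀ g, (∀ i, ψ i g = 0) → g = 0) (apex : Set κ → V)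
    (hapex : ∀ S, (∃ g ∈ coneFace ψ S, g ≠ 0) → apex S ∈ coneFace ψ S ∧ apex S ≠ 0) (k : ℕ) :
    ∀ (S : Set κ) (h : V), h ∈ coneFace ψ S →
      Module.finrank ℝ (⨅ i ∈ S, LinearMap.ker (ψ i) : Submodule ℝ V) ≤ k →
      ∃ k' ≤ k, ∃ (f : Fin k' → V) (p : Fin k' → κ) (t : Fin k' → ℝ),
        (∀ j, 0 ≤ t j) ∧ h = ∑ j, t j • f j ∧
        ∀ j, f j = apex (S ∪ p '' {l | l < j}) ∧ f j ∈ coneFace ψ (S ∪ p '' {l | l < j}) ∧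
          ψ (p j) (f j) ≠ 0 := by
  induction k with
  | zero =>
    intro S h hh hk
    have hbot : (⨅ i ∈ S, LinearMap.ker (ψ i) : Submodule ℝ V) = ⊥ :=
      Submodule.finrank_eq_zero.1 (Nat.le_zero.1 hk)
    have : h ∈ (⨅ i ∈ S, LinearMap.ker (ψ i) : Submodule ℝ V) := by
      simpa [Submodule.mem_iInf] using hh.2
    rw [hbot, Submodule.mem_bot] at this
    exact ⟨0, le_rfl, Fin.elim0, Fin.elim0, Fin.elim0, fun j => j.elim0, by simp [this],
      fun j => j.elim0⟩
  | succ k ih =>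
    intro S h hh hk
    by_cases h0 : h = 0
    · exact ⟨0, Nat.zero_le _, Fin.elim0, Fin.elim0, Fin.elim0, fun j => j.elim0, by simp [h0],
        fun j => j.elim0⟩
    obtain ⟨hg, hg0⟩ := hapex S ⟨h, hh, h0⟩
    set g := apex S with hgdef
    have hpos : ∃ i, 0 < ψ i g := by
      by_contra! hc
      exact hg0 (hψ g fun i => le_antisymm (hc i) (hg.1 i))
    obtain ⟨t, ht, hnn, i, hi, hi0⟩ := exists_max_sub_smul_nonneg hh.1 hpos
    have hmem : h - t • g ∈ coneFace ψ (insert i S) := by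
      refine ⟨hnn, fun j hj => ?_⟩
      rcases hj with rfl | hj
      · exact hi0
      · simp [hh.2 j hj, hg.2 j hj]
    have hlt : (⨅ j ∈ insert i S, LinearMap.ker (ψ j) : Submodule ℝ V) <
        ⨅ j ∈ S, LinearMap.ker (ψ j) := by
      refine lt_of_le_of_ne (biInf_mono fun j hj => Or.inr hj) fun hc => ?_
      have : g ∈ (⨅ j ∈ S, LinearMap.ker (ψ j) : Submodule ℝ V) := by
        simpa [Submodule.mem_iInf] using hg.2
      rw [← hc] at this
      simp only [Submodule.mem_iInf, LinearMap.mem_ker] at this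
      exact hi.ne' (this i (Set.mem_insert _ _))
    have hlt' := Submodule.finrank_lt_finrank_of_lt hlt
    obtain ⟨k', hk', f, p, s, hs, hsum, hprop⟩ := ih (insert i S) _ hmem (by omega)
    have hun : ∀ j : Fin k', S ∪ (Fin.cons i p : Fin (k' + 1) → κ) '' {l | l < j.succ} =
        insert i S ∪ p '' {l | l < j} := by
      intro j
      ext x
      simp only [Set.mem_union, Set.mem_image, Set.mem_ofPred_eq, Set.mem_insert_iff,
        Fin.exists_fin_succ, Fin.cons_zero, Fin.cons_succ, Fin.succ_lt_succ_iff, Fin.succ_pos,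
        true_and]
      constructor
      · rintro (h | h | h)
        exacts [Or.inl (Or.inr h), Or.inl (Or.inl h.symm), Or.inr h]
      · rintro ((h | h) | h)
        exacts [Or.inr (Or.inl h.symm), Or.inl h, Or.inr (Or.inr h)]
    have hz : S ∪ (Fin.cons i p : Fin (k' + 1) → κ) '' {l | l < 0} = S := by simp
    refine ⟨k' + 1, by omega, Fin.cons g f, Fin.cons i p, Fin.cons t s, ?_, ?_, ?_⟩
    · intro j
      refine Fin.cases ?_ (fun j => ?_) j
      · simpa using ht
      · simpa using hs j
    · rw [Fin.sum_univ_succ]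
      simp only [Fin.cons_zero, Fin.cons_succ]
      rw [← hsum]
      abel
    · intro j
      refine Fin.cases ?_ (fun j => ?_) j
      · rw [hz]
        simp only [Fin.cons_zero]
        exact ⟨hgdef, hg, hi.ne'⟩
      · rw [hun]
        simp only [Fin.cons_succ]
        exact hprop j

lemma exists_constraintRay_decomposition [Finite κ] [FiniteDimensional ℝ V]
    {ψ : κ → Module.Dual ℝ V} (hψ : ∀ g, (∀ i, ψ i g = 0) → g = 0) {S : Set κ} {h : V}
    (hh : h ∈ coneFace ψ S) :
    ∃ k ≤ Module.finrank ℝ V, ∃ (f : Fin k → V) (t : Fin k → ℝ), (∀ j, 0 ≤ t j) ∧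
      h = ∑ j, t j • f j ∧ ∀ j, f j ∈ coneFace ψ S ∧ IsConstraintRay ψ (f j) := by
  have hex : ∀ T : Set κ, (∃ g ∈ coneFace ψ T, g ≠ 0) →
      ∃ g, g ∈ coneFace ψ T ∧ IsConstraintRay ψ g := by
    rintro T ⟨g, hg, hg0⟩
    obtain ⟨r, hr, hray, hz⟩ := exists_constraintRay hψ hg.1 hg0
    exact ⟨r, ⟨hr, fun i hi => hz i (hg.2 i hi)⟩, hray⟩
  let apex : Set κ → V := fun T =>
    if hT : ∃ g ∈ coneFace ψ T, g ≠ 0 then (hex T hT).choose else 0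
  have hspec : ∀ T, (∃ g ∈ coneFace ψ T, g ≠ 0) →
      apex T ∈ coneFace ψ T ∧ IsConstraintRay ψ (apex T) := by
    intro T hT
    simp only [apex, dif_pos hT]
    exact (hex T hT).choose_spec
  obtain ⟨k, hk, f, p, t, ht, hsum, hprop⟩ := exists_peeling hψ apex
    (fun T hT => ⟨(hspec T hT).1, (hspec T hT).2.1⟩) (Module.finrank ℝ V) S h hh
    (Submodule.finrank_le _)
  refine ⟨k, hk, f, t, ht, hsum, fun j => ?_⟩
  obtain ⟨h1, h2, h3⟩ := hprop j
  refine ⟨⟨h2.1, fun i hi => h2.2 i (Or.inl hi)⟩, ?_⟩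
  rw [h1]
  refine (hspec _ ⟨f j, h2, ?_⟩).2
  rintro h0
  exact h3 (by simp [h0])

end Cones

section WeakCutting

/-- A nonnegative combination of `k` vectors is one of `n ≥ k` vectors, with repetitions. -/
lemma exists_reindex_sum_smul {V : Type*} [AddCommGroup V] [Module ℝ V] {k n : ℕ} (hkn : k ≤ n)
    (hk : 0 < k) (f : Fin k → V) (t : Fin k → ℝ) (ht : ∀ j, 0 ≤ t j) :
    ∃ (e : Fin n → Fin k) (t' : Fin n → ℝ), (∀ i, 0 ≤ t' i) ∧
      ∑ j, t j • f j = ∑ i, t' i • f (e i) := by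
  obtain ⟨r, rfl⟩ := Nat.exists_eq_add_of_le hkn
  refine ⟨Fin.addCases id fun _ => ⟨0, hk⟩, Fin.addCases t fun _ => 0, fun i => ?_, ?_⟩
  · refine Fin.addCases (fun i => ?_) (fun i => ?_) i
    · simpa using ht i
    · simp
  · simp [Fin.sum_univ_add]

lemma exists_tuple_constraints_of_isRay {V ι : Type*} [AddCommGroup V] [Module ℝ V]
    [FiniteDimensional ℝ V] {d : ℕ} (hd : 1 ≤ d) (hV : Module.finrank ℝ V = d + 1)
    (χ : ι → Module.Dual ℝ V) {Z : Set ι} {g : V} (hg0 : g ≠ 0) (hgZ : ∀ i ∈ Z, χ i g = 0)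
    (hZ : ∀ w, (∀ i ∈ Z, χ i w = 0) → ∃ c : ℝ, w = c • g) :
    ∃ Y : Fin d → ι, (∀ j, Y j ∈ Z) ∧ ∀ w, (∀ j, χ (Y j) w = 0) → ∃ c : ℝ, w = c • g := by
  have hne : Z.Nonempty := by
    by_contra! hc
    have : Module.finrank ℝ V ≤ 1 := finrank_le_one g fun w => by
      obtain ⟨c, hc⟩ := hZ w (by simp [hc])
      exact ⟨c, hc.symm⟩
    omega
  obtain ⟨z₀, hz₀⟩ := hne
  have key : ∀ k : ℕ, ∃ Y : Fin k → ι, (∀ j, Y j ∈ Z) ∧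
      Module.finrank ℝ (⨅ j, LinearMap.ker (χ (Y j)) : Submodule ℝ V) ≤ max 1 (d + 1 - k) := by
    intro k
    induction k with
    | zero => exact ⟨Fin.elim0, fun j => j.elim0, (Submodule.finrank_le _).trans (by simp [hV])⟩
    | succ k ih =>
      obtain ⟨Y, hYZ, hY⟩ := ih
      have hinf : ∀ z, (⨅ j, LinearMap.ker (χ ((Fin.cons z Y : Fin (k + 1) → ι) j)) :
          Submodule ℝ V) = LinearMap.ker (χ z) ⊓ ⨅ j, LinearMap.ker (χ (Y j)) := by
        intro z
        ext w
        simp [Submodule.mem_iInf, Fin.forall_fin_succ]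
      have hmem : ∀ z ∈ Z, ∀ j, (Fin.cons z Y : Fin (k + 1) → ι) j ∈ Z := fun z hz j =>
        Fin.cases (by simpa using hz) (fun j => by simpa using hYZ j) j
      by_cases hall : ∀ w ∈ (⨅ j, LinearMap.ker (χ (Y j)) : Submodule ℝ V), ∃ c : ℝ, w = c • g
      · refine ⟨Fin.cons z₀ Y, hmem z₀ hz₀, ?_⟩
        rw [hinf]
        refine (Submodule.finrank_mono inf_le_right).trans (le_max_of_le_left ?_)
        have hle : (⨅ j, LinearMap.ker (χ (Y j)) : Submodule ℝ V) ≤ Submodule.span ℝ {g} := by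
          intro w hw
          obtain ⟨c, rfl⟩ := hall w hw
          exact Submodule.smul_mem _ _ (Submodule.mem_span_singleton_self g)
        refine (Submodule.finrank_mono hle).trans ?_
        simpa using finrank_span_le_card (R := ℝ) ({g} : Set V)
      · push Not at hall
        obtain ⟨w, hw, hwc⟩ := hall
        obtain ⟨z, hz, hzw⟩ : ∃ z ∈ Z, χ z w ≠ 0 := by
          by_contra! hc
          obtain ⟨c, hc⟩ := hZ w hc
          exact hwc c hc
        refine ⟨Fin.cons z Y, hmem z hz, ?_⟩
        have hlt : (⨅ j, LinearMap.ker (χ ((Fin.cons z Y : Fin (k + 1) → ι) j)) :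
            Submodule ℝ V) < ⨅ j, LinearMap.ker (χ (Y j)) := by
          rw [hinf]
          refine lt_of_le_of_ne inf_le_right fun hc => hzw ?_
          rw [← hc] at hw
          exact hw.1
        have := Submodule.finrank_lt_finrank_of_lt hlt
        omega
  obtain ⟨Y, hYZ, hY⟩ := key d
  refine ⟨Y, hYZ, fun w hw => ?_⟩
  have h1 : Module.finrank ℝ (⨅ j, LinearMap.ker (χ (Y j)) : Submodule ℝ V) ≤ 1 := by
    simpa using hY
  have hgm : g ∈ (⨅ j, LinearMap.ker (χ (Y j)) : Submodule ℝ V) := by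
    simpa [Submodule.mem_iInf] using fun j => hgZ _ (hYZ j)
  have hwm : w ∈ (⨅ j, LinearMap.ker (χ (Y j)) : Submodule ℝ V) := by
    simpa [Submodule.mem_iInf] using hw
  obtain ⟨v, hv⟩ := finrank_le_one_iff.1 h1
  obtain ⟨a, ha⟩ := hv ⟨g, hgm⟩
  obtain ⟨b, hb⟩ := hv ⟨w, hwm⟩
  have ha' : a • (v : V) = g := congrArg Subtype.val ha
  have hb' : b • (v : V) = w := congrArg Subtype.val hb
  have ha0 : a ≠ 0 := by
    rintro rfl
    exact hg0 (by simpa using ha'.symm)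
  refine ⟨b / a, ?_⟩
  rw [← ha', ← hb', smul_smul, div_mul_cancel₀ _ ha0]

/-- The normalised ray of the simplicial cone of `x` on which the constraints in `Y` are tight, or
`0` if there is no such ray. -/
def tightRay {V ι : Type*} [AddCommGroup V] [Module ℝ V] {d : ℕ} (χ : ι → Module.Dual ℝ V)
    (x : Module.Basis (Fin (d + 1)) ℝ V) (Y : Fin d → ι) : V :=
  if h : ∃ g, g ≠ 0 ∧ (∀ i, 0 ≤ x.coord i g) ∧ (∀ j, χ (Y j) g = 0) ∧
    ∀ w, (∀ j, χ (Y j) w = 0) → ∃ c : ℝ, w = c • g then h.choose else 0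

lemma tightRay_coord_nonneg {V ι : Type*} [AddCommGroup V] [Module ℝ V] {d : ℕ}
    (χ : ι → Module.Dual ℝ V) (x : Module.Basis (Fin (d + 1)) ℝ V) (Y : Fin d → ι)
    (i : Fin (d + 1)) : 0 ≤ x.coord i (tightRay χ x Y) := by
  unfold tightRay
  split_ifs with h
  · exact h.choose_spec.2.1 i
  · simp

lemma exists_pos_smul_tightRay {V ι : Type*} [AddCommGroup V] [Module ℝ V] {d : ℕ}
    (χ : ι → Module.Dual ℝ V) (x : Module.Basis (Fin (d + 1)) ℝ V) (Y : Fin d → ι) {g : V}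
    (hg0 : g ≠ 0) (hg : ∀ i, 0 ≤ x.coord i g) (hgY : ∀ j, χ (Y j) g = 0)
    (hY : ∀ w, (∀ j, χ (Y j) w = 0) → ∃ c : ℝ, w = c • g) :
    ∃ c : ℝ, 0 < c ∧ g = c • tightRay χ x Y := by
  have h : ∃ g, g ≠ 0 ∧ (∀ i, 0 ≤ x.coord i g) ∧ (∀ j, χ (Y j) g = 0) ∧
    ∀ w, (∀ j, χ (Y j) w = 0) → ∃ c : ℝ, w = c • g := ⟨g, hg0, hg, hgY, hY⟩
  have hr : tightRay χ x Y = h.choose := dif_pos h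
  obtain ⟨h0, h1, h2, h3⟩ := h.choose_spec
  rw [← hr] at h0 h1 h2 h3
  obtain ⟨c, hc⟩ := h3 g hgY
  refine ⟨c, ?_, hc⟩
  obtain ⟨i, hi⟩ : ∃ i, x.coord i (tightRay χ x Y) ≠ 0 := by
    by_contra! hc
    exact h0 (x.forall_coord_eq_zero_iff.1 hc)
  have hi' := lt_of_le_of_ne (h1 i) hi.symm
  have hgi := hg i
  rw [hc, map_smul, smul_eq_mul] at hgi
  have hc0 : c ≠ 0 := by
    rintro rfl
    exact hg0 (by simpa using hc)
  exact lt_of_le_of_ne (nonneg_of_mul_nonneg_left hgi hi') hc0.symm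

/-- A simplicial cone can be covered by polynomially many simplicial subcones, each of which is
crossed by at most `m` of the given functionals. -/
lemma exists_weak_cutting {d : ℕ} (hd : 1 ≤ d) :
    ∃ C : ℝ, 0 < C ∧ ∀ {V κ : Type*} [AddCommGroup V] [Module ℝ V] [Fintype κ]
      (ψ : κ → Module.Dual ℝ V) (x : Module.Basis (Fin (d + 1)) ℝ V) (m : ℝ), 0 < m →
      ∃ Q : Finset V, (Q.card : ℝ) ≤ C * (1 + Fintype.card κ / m) ^ (2 * d) ∧
        (∀ q ∈ Q, ∀ i, 0 ≤ x.coord i q) ∧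
        ∀ h, (∀ i, 0 ≤ x.coord i h) → ∃ (q : Fin (d + 1) → V) (t : Fin (d + 1) → ℝ),
          (∀ i, q i ∈ Q) ∧ (∀ i, 0 ≤ t i) ∧ h = ∑ i, t i • q i ∧
          ((Finset.univ.filter fun k => ∃ i j, ψ k (q i) < 0 ∧ 0 < ψ k (q j)).card : ℝ) ≤ m := by
  obtain ⟨α, hα1, hα⟩ := exists_sample_of_forall_disjoint ((d + 1) * d) (d + 1)
  refine ⟨2 * (α + d + 1) ^ d, by positivity, ?_⟩
  intro V κ _ _ _ ψ x m hm
  have hfin : FiniteDimensional ℝ V := Module.Basis.finiteDimensional_of_finite x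
  have hV : Module.finrank ℝ V = d + 1 := by simp [Module.finrank_eq_card_basis x]
  let χ : κ ⊕ Fin (d + 1) → Module.Dual ℝ V := Sum.elim ψ x.coord
  let N : Finset (κ ⊕ Fin (d + 1)) := Finset.univ.map Function.Embedding.inl
  have hNc : Nᶜ = Finset.univ.map Function.Embedding.inr := by
    ext z
    cases z <;> simp [N]
  have hNcard : N.card = Fintype.card κ := by simp [N]
  have hNc' : Nᶜ.card = d + 1 := by simp [hNc]
  let ρ : (Fin ((d + 1) * d) → κ ⊕ Fin (d + 1)) → Fin (d + 1) → V :=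
    fun Y i => tightRay χ x fun j => Y (finProdFinEquiv (i, j))
  let K : (Fin ((d + 1) * d) → κ ⊕ Fin (d + 1)) → Finset (κ ⊕ Fin (d + 1)) := fun Y =>
    Finset.univ.filter fun z => ∃ i j, χ z (ρ Y i) < 0 ∧ 0 < χ z (ρ Y j)
  have hK : ∀ Y, K Y ⊆ N := by
    intro Y z hz
    obtain ⟨i, j, hi, hj⟩ := (Finset.mem_filter.1 hz).2
    cases z with
    | inl k => simp [N]
    | inr l => exact absurd hi (not_lt.2 (tightRay_coord_nonneg χ x _ l))
  obtain ⟨S, hSN, hScard, hS⟩ := hα N (by convert hNc') K hK m hm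
  let Q : Finset V := insert 0 ((Fintype.piFinset fun _ : Fin d => S ∪ Nᶜ).image (tightRay χ x))
  refine ⟨Q, ?_, ?_, ?_⟩
  · have h1 : Q.card ≤ (S.card + (d + 1)) ^ d + 1 := by
      refine (Finset.card_insert_le _ _).trans (Nat.add_le_add_right
        (Finset.card_image_le.trans ?_) 1)
      rw [Fintype.card_piFinset, Finset.prod_const, Finset.card_univ, Fintype.card_fin]
      refine Nat.pow_le_pow_left ((Finset.card_union_le _ _).trans ?_) d
      simp [hNc]
    rw [hNcard] at hScard
    set e : ℝ := 1 + Fintype.card κ / m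
    have he1 : 1 ≤ e := le_add_of_nonneg_right (by positivity)
    have he2 : 1 ≤ e ^ 2 := one_le_pow₀ he1
    have h2 : ((S.card : ℝ) + (d + 1)) ^ d ≤ ((α + d + 1) * e ^ 2) ^ d := by
      gcongr
      nlinarith [(Nat.cast_nonneg d : (0 : ℝ) ≤ d)]
    have h3 : 1 ≤ ((α + d + 1) * e ^ 2) ^ d :=
      one_le_pow₀ (one_le_mul_of_one_le_of_one_le
        (by linarith [(Nat.cast_nonneg d : (0 : ℝ) ≤ d)]) he2)
    calc (Q.card : ℝ) ≤ ((S.card : ℝ) + (d + 1)) ^ d + 1 := by exact_mod_cast h1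
      _ ≤ 2 * ((α + d + 1) * e ^ 2) ^ d := by linarith
      _ = 2 * (α + d + 1) ^ d * e ^ (2 * d) := by
        rw [mul_pow, pow_mul, mul_assoc]
  · intro q hq i
    rcases Finset.mem_insert.1 hq with rfl | hq
    · simp
    · obtain ⟨Y, -, rfl⟩ := Finset.mem_image.1 hq
      exact tightRay_coord_nonneg χ x Y i
  · intro h hh
    let σ : κ ⊕ Fin (d + 1) → ℝ := fun z => if 0 ≤ χ z h then 1 else -1
    have hσ0 : ∀ z, σ z ≠ 0 := fun z => by
      simp only [σ]
      split_ifs <;> norm_num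
    have hσinr : ∀ i, σ (Sum.inr i) = 1 := fun i => if_pos (hh i)
    let ψ' : {z // z ∈ S ∪ Nᶜ} → Module.Dual ℝ V := fun z => σ z • χ z
    have hmemr : ∀ i, Sum.inr i ∈ S ∪ Nᶜ := fun i => by simp [hNc]
    have hpt : ∀ g, (∀ z, ψ' z g = 0) → g = 0 := by
      intro g hg
      refine x.forall_coord_eq_zero_iff.1 fun i => ?_
      simpa [ψ', hσinr, χ] using hg ⟨_, hmemr i⟩
    have hhC : h ∈ coneFace ψ' ∅ := by
      refine ⟨fun z => ?_, by simp⟩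
      by_cases hz : 0 ≤ χ z h
      · simp [ψ', σ, hz]
      · simpa [ψ', σ, hz] using (not_le.1 hz).le
    obtain ⟨k, hk, f, t, ht, hsum, hf⟩ := exists_constraintRay_decomposition hpt hhC
    rcases Nat.eq_zero_or_pos k with rfl | hk0
    · refine ⟨fun _ => 0, fun _ => 0, fun _ => Finset.mem_insert_self _ _, by simp, ?_, ?_⟩
      · simpa using hsum
      · simp [hm.le]
    have hray : ∀ j, ∃ (Y : Fin d → κ ⊕ Fin (d + 1)) (c : ℝ), (∀ l, Y l ∈ S ∪ Nᶜ) ∧ 0 < c ∧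
        f j = c • tightRay χ x Y := by
      intro j
      obtain ⟨⟨hnn, -⟩, hne, hall⟩ := hf j
      obtain ⟨Y, hYZ, hY⟩ := exists_tuple_constraints_of_isRay hd hV ψ'
        (Z := {z | ψ' z (f j) = 0}) hne (fun z hz => hz) hall
      have hiff : ∀ z w, ψ' z w = 0 ↔ χ z w = 0 := fun z w => by simp [ψ', hσ0]
      obtain ⟨c, hc, hc'⟩ := exists_pos_smul_tightRay χ x (fun l => (Y l : κ ⊕ Fin (d + 1))) hne
        (fun i => by simpa [ψ', hσinr, χ] using hnn ⟨_, hmemr i⟩)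
        (fun l => (hiff _ _).1 (hYZ l)) (fun w hw => hY w fun l => (hiff _ _).2 (hw l))
      exact ⟨_, c, fun l => (Y l).2, hc, hc'⟩
    choose Y c hYmem hc hfc using hray
    rw [hV] at hk
    obtain ⟨e, t', ht', hsum'⟩ := exists_reindex_sum_smul hk hk0 f t ht
    let Y' : Fin ((d + 1) * d) → κ ⊕ Fin (d + 1) := fun z =>
      Y (e (finProdFinEquiv.symm z).1) (finProdFinEquiv.symm z).2
    have hρ : ∀ i, ρ Y' i = tightRay χ x (Y (e i)) := by
      intro i
      simp only [ρ, Y', Equiv.symm_apply_apply]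
    refine ⟨ρ Y', fun i => t' i * c (e i), ?_, ?_, ?_, ?_⟩
    · intro i
      rw [hρ]
      exact Finset.mem_insert_of_mem (Finset.mem_image_of_mem _
        (Fintype.mem_piFinset.2 fun l => hYmem _ l))
    · exact fun i => mul_nonneg (ht' i) (hc _).le
    · rw [hsum, hsum']
      refine Finset.sum_congr rfl fun i _ => ?_
      rw [hρ, mul_smul, ← hfc]
    · have hKm := hS Y' (by
        intro a hz2
        rcases Finset.mem_union.1 (hYmem (e (finProdFinEquiv.symm a).1)
          (finProdFinEquiv.symm a).2) with h | h
        · exact h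
        · exact absurd hz2 (Finset.mem_compl.1 h)) (by
        intro z hzS hzK
        obtain ⟨i, j, hi, hj⟩ := (Finset.mem_filter.1 hzK).2
        have hs : ∀ i, 0 ≤ σ z * χ z (ρ Y' i) := by
          intro i
          have h1 := (hf (e i)).1.1 ⟨z, Finset.mem_union_left _ hzS⟩
          rw [hfc, ← hρ] at h1
          simp only [ψ', LinearMap.smul_apply, map_smul, smul_eq_mul] at h1
          have h2 := hc (e i)
          by_contra! h3
          nlinarith
        rcases lt_or_gt_of_ne (hσ0 z) with h0 | h0
        · nlinarith [hs j]
        · nlinarith [hs i])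
      refine le_trans ?_ hKm
      norm_cast
      rw [← Finset.card_map (Function.Embedding.inl : κ ↪ κ ⊕ Fin (d + 1))]
      refine Finset.card_le_card fun z hz => ?_
      obtain ⟨k, hk, rfl⟩ := Finset.mem_map.1 hz
      exact Finset.mem_filter.2 ⟨Finset.mem_univ _, (Finset.mem_filter.1 hk).2⟩

end WeakCutting

section TightRays

variable {V ι : Type*} [AddCommGroup V] [Module ℝ V]

/-- The sum of the absolute values at `g` of the functionals indexed by `A`. -/
def absSum (φ : ι → Module.Dual ℝ V) (A : Finset ι) (g : V) : ℝ := ∑ a ∈ A, |φ a g|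

lemma absSum_nonneg (φ : ι → Module.Dual ℝ V) (A : Finset ι) (g : V) : 0 ≤ absSum φ A g :=
  Finset.sum_nonneg fun _ _ => abs_nonneg _

lemma absSum_smul (φ : ι → Module.Dual ℝ V) (A : Finset ι) (c : ℝ) (g : V) :
    absSum φ A (c • g) = |c| * absSum φ A g := by
  simp [absSum, Finset.mul_sum, abs_mul]

lemma absSum_add_of_mul_nonneg {φ : ι → Module.Dual ℝ V} {A : Finset ι} {g g' : V}
    (h : ∀ a ∈ A, 0 ≤ φ a g * φ a g') : absSum φ A (g + g') = absSum φ A g + absSum φ A g' := by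
  rw [absSum, absSum, absSum, ← Finset.sum_add_distrib]
  refine Finset.sum_congr rfl fun a ha => ?_
  rw [map_add]
  exact abs_add_eq_add_abs_iff _ _ |>.2 (mul_nonneg_iff.1 (h a ha))

variable [Fintype ι]

/-- The vectors of `absSum` one at which at least `d` of the functionals vanish. -/
def tightRays (φ : ι → Module.Dual ℝ V) (A : Finset ι) (d : ℕ) : Set V :=
  {g | absSum φ A g = 1 ∧ d ≤ (Finset.univ.filter fun i => φ i g = 0).card}

variable {φ : ι → Module.Dual ℝ V} {A : Finset ι} {d : ℕ}

lemma ne_zero_of_mem_tightRays {g : V} (hg : g ∈ tightRays φ A d) : g ≠ 0 := by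
  rintro rfl
  simpa [absSum] using hg.1

lemma absSum_pos (hφ : ∀ g : V, g ≠ 0 → (Finset.univ.filter fun i => φ i g = 0).card ≤ d)
    (hA : A.card = d + 1) {g : V} (hg : g ≠ 0) : 0 < absSum φ A g := by
  refine (absSum_nonneg φ A g).lt_of_ne fun h => ?_
  have h0 := (Finset.sum_eq_zero_iff_of_nonneg fun a _ => abs_nonneg (φ a g)).1 h.symm
  have : A ⊆ Finset.univ.filter fun i => φ i g = 0 := fun a ha => by simpa using h0 a ha
  have := (Finset.card_le_card this).trans (hφ g hg)
  omega

lemma exists_eq_smul_of_common_zeros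
    (hφ : ∀ g : V, g ≠ 0 → (Finset.univ.filter fun i => φ i g = 0).card ≤ d)
    (hA : A.card = d + 1) {B : Finset ι} (hB : B.card = d) {g g' : V} (hg : g ≠ 0)
    (h : ∀ p ∈ B, φ p g = 0) (h' : ∀ p ∈ B, φ p g' = 0) : ∃ c : ℝ, g' = c • g := by
  obtain ⟨a, -, ha⟩ := Finset.exists_mem_notMem_of_card_lt_card (s := B) (t := A) (by omega)
  have key : ∀ w : V, (∀ p ∈ B, φ p w = 0) → φ a w = 0 → w = 0 := by
    intro w hw hwa
    by_contra hw0
    have : insert a B ⊆ Finset.univ.filter fun i => φ i w = 0 := by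
      intro p hp
      rcases Finset.mem_insert.1 hp with rfl | hp
      · simpa using hwa
      · simpa using hw p hp
    have := (Finset.card_le_card this).trans (hφ w hw0)
    rw [Finset.card_insert_of_notMem ha] at this
    omega
  have hag : φ a g ≠ 0 := fun h0 => hg (key g h h0)
  refine ⟨φ a g' / φ a g, sub_eq_zero.1 (key _ (fun p hp => ?_) ?_)⟩
  · simp [h p hp, h' p hp]
  · simp [hag]

lemma eq_of_common_zeros_of_sign_eq
    (hφ : ∀ g : V, g ≠ 0 → (Finset.univ.filter fun i => φ i g = 0).card ≤ d)
    (hA : A.card = d + 1) {B : Finset ι} (hB : B.card = d) {g g' : V}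
    (hg : absSum φ A g = 1) (hg' : absSum φ A g' = 1)
    (h : ∀ p ∈ B, φ p g = 0) (h' : ∀ p ∈ B, φ p g' = 0)
    (hs : ∀ a ∈ A, SignType.sign (φ a g) = SignType.sign (φ a g')) : g = g' := by
  have hg0 : g ≠ 0 := by
    rintro rfl
    simp [absSum] at hg
  obtain ⟨c, rfl⟩ := exists_eq_smul_of_common_zeros hφ hA hB hg0 h h'
  rw [absSum_smul, hg, mul_one] at hg'
  obtain ⟨a, ha, hag⟩ : ∃ a ∈ A, φ a g ≠ 0 := by
    by_contra! h0
    rw [absSum, Finset.sum_eq_zero fun a ha => by simp [h0 a ha]] at hg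
    exact zero_ne_one hg
  have hsa := hs a ha
  rcases eq_or_eq_neg_of_abs_eq hg' with rfl | rfl
  · simp
  · exfalso
    simp only [map_smul, smul_eq_mul, neg_mul, one_mul, Left.sign_neg] at hsa
    rcases lt_or_gt_of_ne hag with h0 | h0
    · simp [sign_neg h0] at hsa
    · simp [sign_pos h0] at hsa

lemma finite_tightRays
    (hφ : ∀ g : V, g ≠ 0 → (Finset.univ.filter fun i => φ i g = 0).card ≤ d)
    (hA : A.card = d + 1) : (tightRays φ A d).Finite := by
  refine Set.Finite.of_injOn (f := fun g i => SignType.sign (φ i g)) (t := Set.univ)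
    (fun _ _ => Set.mem_univ _) (fun g hg g' hg' h => ?_) Set.finite_univ
  have h1 : ∀ i, SignType.sign (φ i g) = SignType.sign (φ i g') := fun i => congrFun h i
  refine eq_of_common_zeros_of_sign_eq hφ hA
    ((hφ g (ne_zero_of_mem_tightRays hg)).antisymm hg.2) hg.1 hg'.1 (fun p hp => by simpa using hp)
    (fun p hp => ?_) fun a _ => h1 a
  rw [← sign_eq_zero_iff, ← h1, sign_eq_zero_iff]
  simpa using hp

lemma exists_dual_injOn {s : Set V} (hs : s.Finite) : ∃ u : Module.Dual ℝ V, Set.InjOn u s := by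
  obtain ⟨u, hu⟩ := Module.exists_dual_forall_apply_ne_zero (K := ℝ)
    (v := fun x : {x : hs.toFinset × hs.toFinset // x.1 ≠ x.2} => (x.1.1 : V) - x.1.2)
    fun x => sub_ne_zero.2 fun h => x.2 (Subtype.ext h)
  refine ⟨u, fun g hg g' hg' h => ?_⟩
  by_contra hne
  refine hu ⟨(⟨g, hs.mem_toFinset.2 hg⟩, ⟨g', hs.mem_toFinset.2 hg'⟩),
    fun h => hne (congrArg Subtype.val h)⟩ ?_
  simp [h]

end TightRays

section MinSimplex

variable {V ι : Type*} [AddCommGroup V] [Module ℝ V] [Fintype ι] {d : ℕ}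

/-- The indices outside `A` whose functional vanishes at some `f i`. -/
def touching (φ : ι → Module.Dual ℝ V) (A : Finset ι) (f : Fin (d + 1) → V) : Finset ι :=
  Finset.univ.filter fun q => q ∉ A ∧ ∃ i, φ q (f i) = 0

/-- The indices whose functional takes both strict signs on the `f i`. -/
def crossing (φ : ι → Module.Dual ℝ V) (f : Fin (d + 1) → V) : Finset ι :=
  Finset.univ.filter fun q => ∃ i j, φ q (f i) < 0 ∧ 0 < φ q (f j)

variable {φ : ι → Module.Dual ℝ V} {A S : Finset ι} {u : Module.Dual ℝ V}

lemma mul_nonneg_of_notMem_crossing {f : Fin (d + 1) → V} {q : ι} (hq : q ∉ crossing φ f)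
    (i j : Fin (d + 1)) : 0 ≤ φ q (f i) * φ q (f j) := by
  have h1 : ¬ ∃ i j, φ q (f i) < 0 ∧ 0 < φ q (f j) := fun h => hq (by simpa [crossing] using h)
  push Not at h1
  rcases lt_trichotomy (φ q (f i)) 0 with hi | hi | hi
  · exact mul_nonneg_of_nonpos_of_nonpos hi.le (h1 i j hi)
  · simp [hi]
  · exact mul_nonneg hi.le (not_lt.1 fun hj => (h1 j i hj).not_gt hi)

lemma card_touching_le (hφ : ∀ g : V, g ≠ 0 → (Finset.univ.filter fun i => φ i g = 0).card ≤ d)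
    {f : Fin (d + 1) → V} (hf : ∀ i, f i ≠ 0) : (touching φ A f).card ≤ (d + 1) * d := by
  have : touching φ A f ⊆ Finset.univ.biUnion fun i => Finset.univ.filter fun q => φ q (f i) = 0 := by
    intro q hq
    obtain ⟨-, i, hi⟩ := (Finset.mem_filter.1 hq).2
    simpa using ⟨i, hi⟩
  refine (Finset.card_le_card this).trans ?_
  simpa using Finset.card_biUnion_le_card_mul Finset.univ
    (fun i => Finset.univ.filter fun q => φ q (f i) = 0) d fun i _ => hφ _ (hf i)

/-- The rays `f i` span a simplicial cone produced by peeling: `f i` minimizes `u` on the face cut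
out by `p j`, `j < i`, of the cell in which the `f i` lie, and this is witnessed by the functionals
indexed by `A` or vanishing at some `f i`. -/
structure IsMinSimplex (φ : ι → Module.Dual ℝ V) (A : Finset ι) (u : Module.Dual ℝ V)
    (f : Fin (d + 1) → V) (p : Fin d → ι) : Prop where
  mem_tightRays : ∀ i, f i ∈ tightRays φ A d
  linearIndependent : LinearIndependent ℝ f
  eq_zero : ∀ (i : Fin (d + 1)) (j : Fin d), j.castSucc < i → φ (p j) (f i) = 0
  ne_zero : ∀ j : Fin d, φ (p j) (f j.castSucc) ≠ 0
  notMem_crossing : ∀ q ∈ A ∪ touching φ A f, q ∉ crossing φ f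
  le : ∀ (i : Fin (d + 1)) (g : V),
    (∀ q ∈ A ∪ touching φ A f, 0 ≤ φ q g * φ q (∑ l, f l)) →
      (∀ j : Fin d, j.castSucc < i → φ (p j) g = 0) → u (f i) * absSum φ A g ≤ u g

namespace IsMinSimplex

variable {f f' : Fin (d + 1) → V} {p : Fin d → ι}

lemma injective (h : IsMinSimplex φ A u f p) : Function.Injective p := by
  intro i j hij
  rcases lt_trichotomy i j with hlt | heq | hlt
  · exact absurd (h.eq_zero _ i (Fin.castSucc_lt_castSucc_iff.2 hlt)) (hij ▸ h.ne_zero j)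
  · exact heq
  · exact absurd (h.eq_zero _ j (Fin.castSucc_lt_castSucc_iff.2 hlt)) (hij ▸ h.ne_zero i)

lemma mem_union (h : IsMinSimplex φ A u f p) (hS : touching φ A f ⊆ S) (j : Fin d) :
    p j ∈ S ∪ A := by
  by_cases hA : p j ∈ A
  · exact Finset.mem_union_right _ hA
  · refine Finset.mem_union_left _ (hS (Finset.mem_filter.2
      ⟨Finset.mem_univ _, hA, Fin.last d, h.eq_zero _ j (Fin.castSucc_lt_last j)⟩))

lemma notMem_crossing_of_mem_union (h : IsMinSimplex φ A u f p) (hS : Disjoint S (crossing φ f))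
    {q : ι} (hq : q ∈ S ∪ A) : q ∉ crossing φ f := by
  rcases Finset.mem_union.1 hq with hq | hq
  · exact Finset.disjoint_left.1 hS hq
  · exact h.notMem_crossing q (Finset.mem_union_left _ hq)

lemma last_eq (hφ : ∀ g : V, g ≠ 0 → (Finset.univ.filter fun i => φ i g = 0).card ≤ d)
    (hA : A.card = d + 1) (h : IsMinSimplex φ A u f p) (h' : IsMinSimplex φ A u f' p)
    (hs : ∀ a ∈ A, SignType.sign (φ a (f (Fin.last d))) =
      SignType.sign (φ a (f' (Fin.last d)))) : f (Fin.last d) = f' (Fin.last d) := by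
  refine eq_of_common_zeros_of_sign_eq hφ hA (B := Finset.univ.image p) ?_
    (h.mem_tightRays _).1 (h'.mem_tightRays _).1 ?_ ?_ hs
  · simp [Finset.card_image_of_injective _ h.injective]
  · simpa using fun j => h.eq_zero _ j (Fin.castSucc_lt_last j)
  · simpa using fun j => h'.eq_zero _ j (Fin.castSucc_lt_last j)

lemma exists_mul_pos (hφ : ∀ g : V, g ≠ 0 → (Finset.univ.filter fun i => φ i g = 0).card ≤ d)
    (hA : A.card = d + 1) (h : IsMinSimplex φ A u f p) (h' : IsMinSimplex φ A u f' p)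
    (hs : ∀ a ∈ A, SignType.sign (φ a (f (Fin.last d))) =
      SignType.sign (φ a (f' (Fin.last d))))
    (hsp : ∀ j, SignType.sign (φ (p j) (f j.castSucc)) =
      SignType.sign (φ (p j) (f' j.castSucc))) (q : ι) :
    ∃ l, 0 < φ q (f l) * φ q (f' l) := by
  by_cases hq : ∃ j, p j = q
  · obtain ⟨j, rfl⟩ := hq
    refine ⟨j.castSucc, ?_⟩
    have := hsp j
    rcases lt_or_gt_of_ne (h.ne_zero j) with h0 | h0
    · rw [sign_neg h0, eq_comm, sign_eq_neg_one_iff] at this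
      exact mul_pos_of_neg_of_neg h0 this
    · rw [sign_pos h0, eq_comm, sign_eq_one_iff] at this
      exact mul_pos h0 this
  · refine ⟨Fin.last d, ?_⟩
    rw [← last_eq hφ hA h h' hs]
    refine mul_self_pos.2 fun h0 => ?_
    have hsub : insert q (Finset.univ.image p) ⊆
        Finset.univ.filter fun i => φ i (f (Fin.last d)) = 0 := by
      intro i hi
      rcases Finset.mem_insert.1 hi with rfl | hi
      · simpa using h0
      · obtain ⟨j, -, rfl⟩ := Finset.mem_image.1 hi
        simpa using h.eq_zero _ j (Fin.castSucc_lt_last j)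
    have hcard := (Finset.card_le_card hsub).trans
      (hφ _ (ne_zero_of_mem_tightRays (h.mem_tightRays _)))
    rw [Finset.card_insert_of_notMem (by simpa using hq),
      Finset.card_image_of_injective _ h.injective] at hcard
    simp at hcard

lemma apply_le (hφ : ∀ g : V, g ≠ 0 → (Finset.univ.filter fun i => φ i g = 0).card ≤ d)
    (hA : A.card = d + 1) (h : IsMinSimplex φ A u f p) (h' : IsMinSimplex φ A u f' p)
    (hS : touching φ A f ⊆ S) (hK : Disjoint S (crossing φ f)) (hK' : Disjoint S (crossing φ f'))
    (hs : ∀ a ∈ A, SignType.sign (φ a (f (Fin.last d))) =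
      SignType.sign (φ a (f' (Fin.last d))))
    (hsp : ∀ j, SignType.sign (φ (p j) (f j.castSucc)) =
      SignType.sign (φ (p j) (f' j.castSucc))) (i : Fin (d + 1)) : u (f i) ≤ u (f' i) := by
  have key := h.le i (f' i) (fun q hq => ?_) fun j hj => h'.eq_zero i j hj
  · rwa [(h'.mem_tightRays i).1, mul_one] at key
  have hq' : q ∈ S ∪ A := by
    rcases Finset.mem_union.1 hq with hq | hq
    · exact Finset.mem_union_right _ hq
    · exact Finset.mem_union_left _ (hS hq)
  obtain ⟨l, hl⟩ := exists_mul_pos hφ hA h h' hs hsp q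
  have h1 := mul_nonneg_of_notMem_crossing (h'.notMem_crossing_of_mem_union hK' hq') i l
  have h2 : 0 ≤ φ q (f l) * φ q (∑ l, f l) := by
    rw [map_sum, Finset.mul_sum]
    exact Finset.sum_nonneg fun k _ =>
      mul_nonneg_of_notMem_crossing (h.notMem_crossing_of_mem_union hK hq') l k
  have h3 := mul_nonneg (mul_nonneg h1 hl.le) h2
  have h4 : 0 < (φ q (f l) * φ q (f' l)) ^ 2 := by positivity
  refine nonneg_of_mul_nonneg_left (b := (φ q (f l) * φ q (f' l)) ^ 2) ?_ h4
  calc (0 : ℝ) ≤ _ := h3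
    _ = _ := by ring

lemma eq_of_sign_eq (hφ : ∀ g : V, g ≠ 0 → (Finset.univ.filter fun i => φ i g = 0).card ≤ d)
    (hA : A.card = d + 1) (hu : Set.InjOn u (tightRays φ A d))
    (h : IsMinSimplex φ A u f p) (h' : IsMinSimplex φ A u f' p)
    (hS : touching φ A f ⊆ S) (hS' : touching φ A f' ⊆ S)
    (hK : Disjoint S (crossing φ f)) (hK' : Disjoint S (crossing φ f'))
    (hs : ∀ a ∈ A, SignType.sign (φ a (f (Fin.last d))) =
      SignType.sign (φ a (f' (Fin.last d))))
    (hsp : ∀ j, SignType.sign (φ (p j) (f j.castSucc)) =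
      SignType.sign (φ (p j) (f' j.castSucc))) : f = f' := by
  funext i
  exact hu (h.mem_tightRays i) (h'.mem_tightRays i)
    ((apply_le hφ hA h h' hS hK hK' hs hsp i).antisymm
      (apply_le hφ hA h' h hS' hK' hK (fun a ha => (hs a ha).symm) (fun j => (hsp j).symm) i))

end IsMinSimplex

/-- At most `O((#S + #A) ^ d)` minimal simplices are compatible with the sample `S`. -/
lemma card_isMinSimplex_le
    (hφ : ∀ g : V, g ≠ 0 → (Finset.univ.filter fun i => φ i g = 0).card ≤ d)
    (hA : A.card = d + 1) (hu : Set.InjOn u (tightRays φ A d))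
    (T : Finset ((Fin (d + 1) → V) × (Fin d → ι)))
    (hT : ∀ c ∈ T, IsMinSimplex φ A u c.1 c.2 ∧ touching φ A c.1 ⊆ S ∧
      Disjoint S (crossing φ c.1)) :
    T.card ≤ 3 ^ (d + (d + 1)) * (S.card + (d + 1)) ^ d := by
  let F : (Fin (d + 1) → V) × (Fin d → ι) → (Fin d → ι) × (Fin d → SignType) × (A → SignType) :=
    fun c => (c.2, fun j => SignType.sign (φ (c.2 j) (c.1 j.castSucc)),
      fun a => SignType.sign (φ a (c.1 (Fin.last d))))
  have h := Finset.card_le_card_of_injOn (s := T)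
    (t := (Fintype.piFinset fun _ : Fin d => S ∪ A) ×ˢ Finset.univ) F ?_ ?_
  · refine h.trans ?_
    rw [Finset.card_product, Fintype.card_piFinset, Finset.card_univ, Fintype.card_prod,
      Fintype.card_fun, Fintype.card_fun, Fintype.card_coe, hA, Fintype.card_fin, mul_comm, ← pow_add]
    have h3 : Fintype.card SignType = 3 := rfl
    rw [h3, Finset.prod_const, Finset.card_univ, Fintype.card_fin]
    gcongr
    rw [← hA]
    exact Finset.card_union_le S A
  · intro c hc
    have := hT c hc
    simpa [F] using fun j => by simpa using this.1.mem_union this.2.1 j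
  · rintro ⟨f, p⟩ hc ⟨f', p'⟩ hc' heq
    obtain ⟨h1, h2, h3⟩ := hT _ hc
    obtain ⟨h1', h2', h3'⟩ := hT _ hc'
    simp only [F, Prod.mk.injEq] at heq
    obtain ⟨rfl, h4, h5⟩ := heq
    exact Prod.ext (h1.eq_of_sign_eq hφ hA hu h1' h2 h2' h3 h3'
      (fun a ha => congrFun h5 ⟨a, ha⟩) fun j => congrFun h4 j) rfl

end MinSimplex

section Covering

variable {V ι : Type*} [AddCommGroup V] [Module ℝ V] {d : ℕ}
  {φ : ι → Module.Dual ℝ V} {A R S : Finset ι} {u : Module.Dual ℝ V} {σ : ι → ℝ}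

/-- The functionals indexed by `R`, rescaled by `σ`. -/
def scaledOn (φ : ι → Module.Dual ℝ V) (σ : ι → ℝ) (R : Finset ι) : R → Module.Dual ℝ V :=
  fun p => σ p • φ p

lemma scaledOn_eq_zero_iff (hσ : ∀ p, σ p ≠ 0) (p : R) (g : V) :
    scaledOn φ σ R p g = 0 ↔ φ p g = 0 := by
  simp [scaledOn, hσ]

lemma absSum_eq_sum_of_mem_coneFace (hAR : A ⊆ R) (hσ : ∀ p, |σ p| = 1) {T : Set R} {g : V}
    (hg : g ∈ coneFace (scaledOn φ σ R) T) : absSum φ A g = ∑ a ∈ A, σ a * φ a g := by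
  refine Finset.sum_congr rfl fun a ha => ?_
  have h : 0 ≤ σ a * φ a g := hg.1 ⟨a, hAR ha⟩
  rw [← abs_of_nonneg h, abs_mul, hσ, one_mul]

variable [Fintype ι]

lemma eq_zero_of_scaledOn (hφ : ∀ g : V, g ≠ 0 → (Finset.univ.filter fun i => φ i g = 0).card ≤ d)
    (hA : A.card = d + 1) (hAR : A ⊆ R) (hσ : ∀ p, σ p ≠ 0) (g : V)
    (hg : ∀ p, scaledOn φ σ R p g = 0) : g = 0 := by
  by_contra h0
  refine (absSum_pos hφ hA h0).ne' (Finset.sum_eq_zero fun a ha => ?_)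
  rw [(scaledOn_eq_zero_iff hσ ⟨a, hAR ha⟩ g).1 (hg _), abs_zero]

lemma le_card_zeros_of_isConstraintRay [FiniteDimensional ℝ V] (hV : Module.finrank ℝ V = d + 1)
    (hσ : ∀ p, σ p ≠ 0) {g : V} (hg : IsConstraintRay (scaledOn φ σ R) g) :
    d ≤ (R.filter fun p => φ p g = 0).card := by
  set Z := R.filter fun p => φ p g = 0 with hZ
  let L : V →ₗ[ℝ] Z → ℝ := LinearMap.pi fun p => φ p
  have hker : LinearMap.ker L ≤ Submodule.span ℝ {g} := by
    intro w hw
    obtain ⟨c, rfl⟩ := hg.2 w fun p hp => by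
      rw [scaledOn_eq_zero_iff hσ] at hp ⊢
      exact congrFun (LinearMap.mem_ker.1 hw) ⟨p, Finset.mem_filter.2 ⟨p.2, hp⟩⟩
    exact Submodule.smul_mem _ _ (Submodule.mem_span_singleton_self g)
  have h1 := (Submodule.finrank_mono hker).trans (finrank_span_le_card _)
  have h2 := L.finrank_range_add_finrank_ker
  have h3 := Submodule.finrank_le (LinearMap.range L)
  rw [Module.finrank_fintype_fun_eq_card, Fintype.card_coe] at h3
  simp only [Set.toFinset_singleton, Finset.card_singleton] at h1
  omega

lemma mem_of_isConstraintRay [FiniteDimensional ℝ V] (hV : Module.finrank ℝ V = d + 1)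
    (hφ : ∀ g : V, g ≠ 0 → (Finset.univ.filter fun i => φ i g = 0).card ≤ d)
    (hσ : ∀ p, σ p ≠ 0) {g : V} (hg : IsConstraintRay (scaledOn φ σ R) g) {q : ι}
    (hq : φ q g = 0) : q ∈ R := by
  have h1 := le_card_zeros_of_isConstraintRay hV hσ hg
  have h2 := Finset.eq_of_subset_of_card_le
    (Finset.filter_subset_filter (fun p => φ p g = 0) (Finset.subset_univ R)) ((hφ g hg.1).trans h1)
  have h3 : q ∈ Finset.univ.filter fun p => φ p g = 0 := by simpa using hq
  rw [← h2] at h3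
  exact (Finset.mem_filter.1 h3).1

lemma IsConstraintRay.smul {κ : Type*} {ψ : κ → Module.Dual ℝ V} {g : V}
    (hg : IsConstraintRay ψ g) {c : ℝ} (hc : c ≠ 0) : IsConstraintRay ψ (c • g) := by
  refine ⟨smul_ne_zero hc hg.1, fun w hw => ?_⟩
  obtain ⟨e, rfl⟩ := hg.2 w fun i hi => hw i (by simp [hi])
  exact ⟨e / c, by rw [smul_smul, div_mul_cancel₀ _ hc]⟩

lemma coneFace_smul {κ : Type*} {ψ : κ → Module.Dual ℝ V} {T : Set κ} {g : V}
    (hg : g ∈ coneFace ψ T) {c : ℝ} (hc : 0 ≤ c) : c • g ∈ coneFace ψ T :=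
  ⟨fun i => by simpa using mul_nonneg hc (hg.1 i), fun i hi => by simp [hg.2 i hi]⟩

/-- Every nonzero face of a cell has a normalized extreme ray minimizing `u` among the normalized
vectors of the face. -/
lemma exists_min_ray [FiniteDimensional ℝ V] (hV : Module.finrank ℝ V = d + 1)
    (hφ : ∀ g : V, g ≠ 0 → (Finset.univ.filter fun i => φ i g = 0).card ≤ d)
    (hA : A.card = d + 1) (hAR : A ⊆ R) (hσ : ∀ p, |σ p| = 1) (u : Module.Dual ℝ V) (T : Set R)
    (hT : ∃ g ∈ coneFace (scaledOn φ σ R) T, g ≠ 0) :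
    ∃ r ∈ coneFace (scaledOn φ σ R) T, r ∈ tightRays φ A d ∧ (∀ q, φ q r = 0 → q ∈ R) ∧
      ∀ g ∈ coneFace (scaledOn φ σ R) T, u r * absSum φ A g ≤ u g := by
  have hσ0 : ∀ p, σ p ≠ 0 := fun p h => by simpa [h] using hσ p
  have hpt := eq_zero_of_scaledOn hφ hA hAR hσ0
  have hnorm : ∀ g, g ∈ coneFace (scaledOn φ σ R) T → IsConstraintRay (scaledOn φ σ R) g →
      (absSum φ A g)⁻¹ • g ∈ {r | r ∈ tightRays φ A d ∧ r ∈ coneFace (scaledOn φ σ R) T ∧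
        IsConstraintRay (scaledOn φ σ R) r} := by
    intro g hg hr
    have hpos := absSum_pos hφ hA hr.1
    have hr' := hr.smul (inv_ne_zero hpos.ne')
    refine ⟨⟨?_, ?_⟩, coneFace_smul hg (inv_nonneg.2 hpos.le), hr'⟩
    · rw [absSum_smul, abs_of_pos (inv_pos.2 hpos), inv_mul_cancel₀ hpos.ne']
    · exact (le_card_zeros_of_isConstraintRay hV hσ0 hr').trans
        (Finset.card_le_card (Finset.filter_subset_filter _ (Finset.subset_univ R)))
  obtain ⟨g₀, hg₀, hg₀0⟩ := hT
  obtain ⟨r₀, hr₀, hray₀, hz₀⟩ := exists_constraintRay hpt hg₀.1 hg₀0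
  obtain ⟨r, hr, hmin⟩ := Set.exists_min_image _ u
    (((finite_tightRays hφ hA).subset fun _ h => h.1) :
      {r | r ∈ tightRays φ A d ∧ r ∈ coneFace (scaledOn φ σ R) T ∧
        IsConstraintRay (scaledOn φ σ R) r}.Finite)
    ⟨_, hnorm r₀ ⟨hr₀, fun i hi => hz₀ i (hg₀.2 i hi)⟩ hray₀⟩
  refine ⟨r, hr.2.1, hr.1, fun q hq => mem_of_isConstraintRay hV hφ hσ0 hr.2.2 hq, fun g hg => ?_⟩
  obtain ⟨k, -, f, t, ht, rfl, hf⟩ := exists_constraintRay_decomposition hpt hg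
  rw [absSum_eq_sum_of_mem_coneFace hAR hσ hg]
  have h1 : ∑ a ∈ A, σ a * φ a (∑ j, t j • f j) = ∑ j, t j * absSum φ A (f j) := by
    simp only [fun j => absSum_eq_sum_of_mem_coneFace hAR hσ (hf j).1, map_sum, map_smul,
      smul_eq_mul, Finset.mul_sum]
    rw [Finset.sum_comm]
    refine Finset.sum_congr rfl fun j _ => Finset.sum_congr rfl fun a _ => by ring
  rw [h1, Finset.mul_sum, map_sum]
  refine Finset.sum_le_sum fun j _ => ?_
  have hpos := absSum_pos hφ hA (hf j).2.1
  have h2 := hmin _ (hnorm _ (hf j).1 (hf j).2)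
  rw [map_smul, smul_eq_mul, le_inv_mul_iff₀ hpos] at h2
  rw [map_smul, smul_eq_mul]
  calc u r * (t j * absSum φ A (f j)) = t j * (absSum φ A (f j) * u r) := by ring
    _ ≤ t j * u (f j) := mul_le_mul_of_nonneg_left h2 (ht j)

/-- Every vector avoiding the proper subspaces spanned by normalized rays lies in the cone over a
minimal simplex compatible with the sample `S`. -/
lemma exists_isMinSimplex [FiniteDimensional ℝ V] (hV : Module.finrank ℝ V = d + 1)
    (hφ0 : ∀ i, φ i ≠ 0)
    (hφ : ∀ g : V, g ≠ 0 → (Finset.univ.filter fun i => φ i g = 0).card ≤ d)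
    (hA : A.card = d + 1) (u : Module.Dual ℝ V) (S : Finset ι) {h : V}
    (hgen : ∀ s ⊆ tightRays φ A d, Submodule.span ℝ s ≠ ⊤ → h ∉ Submodule.span ℝ s) :
    ∃ (f : Fin (d + 1) → V) (p : Fin d → ι) (t : Fin (d + 1) → ℝ), IsMinSimplex φ A u f p ∧
      touching φ A f ⊆ S ∧ Disjoint S (crossing φ f) ∧ (∀ j, 0 ≤ t j) ∧ h = ∑ j, t j • f j := by
  set R := S ∪ A with hR
  have hAR : A ⊆ R := Finset.subset_union_right
  let σ : ι → ℝ := fun q => if 0 ≤ φ q h then 1 else -1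
  have hσ : ∀ q, |σ q| = 1 := fun q => by
    simp only [σ]
    split_ifs <;> simp
  have hσ0 : ∀ p, σ p ≠ 0 := fun p h => by simpa [h] using hσ p
  have hσσ : ∀ q, σ q * σ q = 1 := fun q => by rw [← abs_mul_abs_self, hσ, one_mul]
  have hmul : ∀ (q : R) g g', φ q g * φ q g' = scaledOn φ σ R q g * scaledOn φ σ R q g' := by
    intro q g g'
    simp only [scaledOn, LinearMap.smul_apply, smul_eq_mul]
    calc _ = (σ q * σ q) * (φ q g * φ q g') := by rw [hσσ, one_mul]
      _ = _ := by ring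
  have hh : h ∈ coneFace (scaledOn φ σ R) ∅ := by
    refine ⟨fun q => ?_, by simp⟩
    by_cases hq : 0 ≤ φ q h
    · simp [scaledOn, σ, hq]
    · simpa [scaledOn, σ, hq] using (not_le.1 hq).le
  have hex : ∀ T : Set R, ∃ r : V, (∃ g ∈ coneFace (scaledOn φ σ R) T, g ≠ 0) →
      r ∈ coneFace (scaledOn φ σ R) T ∧ r ∈ tightRays φ A d ∧ (∀ q, φ q r = 0 → q ∈ R) ∧
        ∀ g ∈ coneFace (scaledOn φ σ R) T, u r * absSum φ A g ≤ u g := by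
    intro T
    by_cases hT : ∃ g ∈ coneFace (scaledOn φ σ R) T, g ≠ 0
    · obtain ⟨r, hr⟩ := exists_min_ray hV hφ hA hAR hσ u T hT
      exact ⟨r, fun _ => hr⟩
    · exact ⟨0, fun hT' => absurd hT' hT⟩
  choose apex hapex using hex
  obtain ⟨k, hk, f, p, t, ht, hsum, hf⟩ := exists_peeling (eq_zero_of_scaledOn hφ hA hAR hσ0) apex
    (fun T hT => ⟨(hapex T hT).1, ne_zero_of_mem_tightRays (hapex T hT).2.1⟩) (d + 1) ∅ h hh
    (hV ▸ Submodule.finrank_le _)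
  have hfne : ∀ j, f j ≠ 0 := fun j h0 => (hf j).2.2 (by simp [h0])
  have hmin : ∀ j, f j ∈ tightRays φ A d ∧ (∀ q, φ q (f j) = 0 → q ∈ R) ∧
      ∀ g ∈ coneFace (scaledOn φ σ R) (∅ ∪ p '' {l | l < j}), u (f j) * absSum φ A g ≤ u g := by
    intro j
    have := (hapex _ ⟨f j, (hf j).2.1, hfne j⟩).2
    rwa [← (hf j).1] at this
  have hspan : Submodule.span ℝ (Set.range f) = ⊤ := by
    by_contra hne
    refine hgen _ (Set.range_subset_iff.2 fun j => (hmin j).1) hne ?_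
    rw [hsum]
    exact Submodule.sum_mem _ fun j _ =>
      Submodule.smul_mem _ _ (Submodule.subset_span (Set.mem_range_self j))
  obtain rfl : k = d + 1 := by
    refine hk.antisymm ?_
    have := finrank_range_le_card (R := ℝ) f
    rwa [Set.finrank, hspan, finrank_top, hV, Fintype.card_fin] at this
  have hnn : ∀ (q : R) i j, 0 ≤ φ q (f i) * φ q (f j) := fun q i j => by
    rw [hmul]
    exact mul_nonneg ((hf i).2.1.1 q) ((hf j).2.1.1 q)
  have hcross : ∀ q ∈ R, q ∉ crossing φ f := by
    intro q hq hc
    obtain ⟨i, j, hi, hj⟩ := (Finset.mem_filter.1 hc).2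
    exact (hnn ⟨q, hq⟩ i j).not_gt (mul_neg_of_neg_of_pos hi hj)
  have htouch : A ∪ touching φ A f ⊆ R := by
    refine Finset.union_subset hAR fun q hq => ?_
    obtain ⟨-, i, hi⟩ := (Finset.mem_filter.1 hq).2
    exact (hmin i).2.1 q hi
  have hpos : ∀ q : R, 0 < scaledOn φ σ R q (∑ l, f l) := by
    intro q
    rw [map_sum]
    refine (Finset.sum_nonneg fun i _ => (hf i).2.1.1 q).lt_of_ne fun h0 => hφ0 q ?_
    have h1 := (Finset.sum_eq_zero_iff_of_nonneg fun i _ => (hf i).2.1.1 q).1 h0.symm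
    refine LinearMap.ext_on hspan ?_
    rintro _ ⟨i, rfl⟩
    simpa using (scaledOn_eq_zero_iff hσ0 q _).1 (h1 i (Finset.mem_univ i))
  refine ⟨f, fun j => p j.castSucc, t, ⟨fun i => (hmin i).1,
    linearIndependent_of_top_le_span_of_card_eq_finrank hspan.ge (by simp [hV]), ?_, ?_, ?_, ?_⟩,
    ?_, ?_, ht, hsum⟩
  · intro i j hj
    exact (scaledOn_eq_zero_iff hσ0 _ _).1 ((hf i).2.1.2 _ (Or.inr ⟨_, hj, rfl⟩))
  · exact fun j => fun h0 => (hf j.castSucc).2.2 ((scaledOn_eq_zero_iff hσ0 _ _).2 h0)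
  · exact fun q hq => hcross q (htouch hq)
  · intro i g hg hgp
    have hg' : ∀ q : R, (q : ι) ∈ A ∪ touching φ A f → 0 ≤ scaledOn φ σ R q g := by
      intro q hq
      have := hg q hq
      rw [hmul] at this
      exact nonneg_of_mul_nonneg_left this (hpos q)
    obtain ⟨ε, hε, hεq⟩ : ∃ ε : ℝ, 0 < ε ∧ ∀ q : R, 0 < scaledOn φ σ R q (f i) →
        0 ≤ scaledOn φ σ R q (f i) + ε * scaledOn φ σ R q g := by
      have : ∀ᶠ ε in nhdsWithin (0 : ℝ) (Set.Ioi 0), ∀ q : R, 0 < scaledOn φ σ R q (f i) →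
          0 ≤ scaledOn φ σ R q (f i) + ε * scaledOn φ σ R q g := by
        refine Filter.eventually_all.2 fun q => ?_
        by_cases hq : 0 < scaledOn φ σ R q (f i)
        · have hc : Filter.Tendsto (fun ε : ℝ => scaledOn φ σ R q (f i) + ε * scaledOn φ σ R q g)
              (nhds 0) (nhds (scaledOn φ σ R q (f i) + 0 * scaledOn φ σ R q g)) :=
            (Continuous.tendsto (by fun_prop) 0)
          rw [zero_mul, add_zero] at hc
          filter_upwards [nhdsWithin_le_nhds (hc.eventually (lt_mem_nhds hq))] with ε hε _
          exact hε.le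
        · exact Filter.Eventually.of_forall fun ε h => absurd h hq
      obtain ⟨ε, h1, h2⟩ := (this.and self_mem_nhdsWithin).exists
      exact ⟨ε, h2, h1⟩
    have hmem : f i + ε • g ∈ coneFace (scaledOn φ σ R) (∅ ∪ p '' {l | l < i}) := by
      refine ⟨fun q => ?_, ?_⟩
      · rw [map_add, map_smul, smul_eq_mul]
        rcases ((hf i).2.1.1 q).lt_or_eq with hq | hq
        · exact hεq q hq
        · rw [← hq, zero_add]
          refine mul_nonneg hε.le (hg' q ?_)
          by_cases hqA : (q : ι) ∈ A
          · exact Finset.mem_union_left _ hqA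
          · exact Finset.mem_union_right _ (Finset.mem_filter.2 ⟨Finset.mem_univ _, hqA, i,
              (scaledOn_eq_zero_iff hσ0 q _).1 hq.symm⟩)
      · rintro q (hq | ⟨l, hl, rfl⟩)
        · exact absurd hq (Set.notMem_empty _)
        · have hl' : (l : ℕ) < d := (Fin.lt_def.1 hl).trans_le (Nat.lt_succ_iff.1 i.2)
          have h1 := (hf i).2.1.2 _ (Or.inr ⟨l, hl, rfl⟩)
          have h2 := hgp ⟨l, hl'⟩ hl
          rw [map_add, map_smul, h1, (scaledOn_eq_zero_iff hσ0 (p l) g).2 h2]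
          simp
    have hle := (hmin i).2.2 _ hmem
    rw [absSum_add_of_mul_nonneg, absSum_smul, (hmin i).1.1, abs_of_pos hε, map_add, map_smul,
      smul_eq_mul, mul_add, mul_one, add_le_add_iff_left] at hle
    · refine le_of_mul_le_mul_left ?_ hε
      linarith
    · intro a ha
      rw [map_smul, smul_eq_mul, mul_left_comm]
      refine mul_nonneg hε.le ?_
      rw [hmul ⟨a, hAR ha⟩]
      exact mul_nonneg ((hf i).2.1.1 _) (hg' ⟨a, hAR ha⟩ (Finset.mem_union_left _ ha))
  · intro q hq
    have := htouch (Finset.mem_union_right _ hq)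
    exact (Finset.mem_union.1 this).resolve_right (Finset.mem_filter.1 hq).2.1
  · exact Finset.disjoint_left.2 fun q hq => hcross q (Finset.mem_union_left _ hq)

end Covering

section ClarksonShor

variable {ι X : Type*}

lemma sum_sampleWeight_mul_sum_filter (p : ℝ) (N : Finset ι) (T : Finset X) (D K : X → Finset ι)
    (hD : ∀ c ∈ T, D c ⊆ N) (hK : ∀ c ∈ T, K c ⊆ N) (hDK : ∀ c ∈ T, Disjoint (D c) (K c))
    (g : X → ℝ) :
    ∑ S ∈ N.powerset, sampleWeight p N S *
        ∑ c ∈ T with D c ⊆ S ∧ Disjoint S (K c), g c =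
      ∑ c ∈ T, g c * (p ^ (D c).card * (1 - p) ^ (K c).card) := by
  simp_rw [Finset.sum_filter, Finset.mul_sum]
  rw [Finset.sum_comm]
  refine Finset.sum_congr rfl fun c hc => ?_
  rw [← sum_sampleWeight_of_subset_of_disjoint p (hD c hc) (hK c hc) (hDK c hc),
    Finset.sum_filter, Finset.mul_sum]
  refine Finset.sum_congr rfl fun S _ => ?_
  split_ifs
  · ring
  · ring

lemma exists_add_one_pow_mul_exp_le (e : ℕ) :
    ∃ B : ℝ, 0 < B ∧ ∀ x : ℝ, 0 ≤ x → (1 + x) ^ e * Real.exp (-(x / 2)) ≤ B := by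
  refine ⟨2 ^ e * e.factorial * Real.exp (1 / 2), by positivity, fun x hx => ?_⟩
  have h1 := Real.pow_div_factorial_le_exp ((1 + x) / 2) (by linarith) e
  have hf : (0 : ℝ) < e.factorial := by positivity
  rw [div_le_iff₀ hf] at h1
  calc (1 + x) ^ e * Real.exp (-(x / 2))
      = 2 ^ e * ((1 + x) / 2) ^ e * Real.exp (-(x / 2)) := by
        rw [div_pow]
        field_simp
    _ ≤ 2 ^ e * (Real.exp ((1 + x) / 2) * e.factorial) * Real.exp (-(x / 2)) := by gcongr
    _ = 2 ^ e * e.factorial * (Real.exp ((1 + x) / 2) * Real.exp (-(x / 2))) := by ring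
    _ = 2 ^ e * e.factorial * Real.exp (1 / 2) := by
        rw [← Real.exp_add]
        ring_nf

lemma one_add_mul_pow_mul_le {e : ℕ} {B p : ℝ}
    (hB : ∀ x : ℝ, 0 ≤ x → (1 + x) ^ e * Real.exp (-(x / 2)) ≤ B) (h0 : 0 ≤ p) (h1 : p ≤ 1)
    (w : ℕ) : (1 + w * p) ^ e * (1 - p) ^ w ≤ B * (1 - p / 2) ^ w := by
  have h2 : 0 ≤ 1 - p / 2 := by linarith
  have h3 : (1 - p / 2) ^ w ≤ Real.exp (-(w * p / 2)) := by
    calc (1 - p / 2) ^ w ≤ Real.exp (-(p / 2)) ^ w := by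
          gcongr
          linarith [Real.add_one_le_exp (-(p / 2))]
      _ = Real.exp (-(w * p / 2)) := by
          rw [← Real.exp_nat_mul]
          ring_nf
  have h4 : (1 - p) ^ w ≤ (1 - p / 2) ^ w * (1 - p / 2) ^ w := by
    rw [← mul_pow]
    have : 0 ≤ 1 - p := by linarith
    gcongr
    nlinarith
  calc (1 + w * p) ^ e * (1 - p) ^ w
      ≤ (1 + w * p) ^ e * ((1 - p / 2) ^ w * Real.exp (-(w * p / 2))) := by
        gcongr
        exact h4.trans (by gcongr)
    _ = ((1 + w * p) ^ e * Real.exp (-(w * p / 2))) * (1 - p / 2) ^ w := by ring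
    _ ≤ B * (1 - p / 2) ^ w := by
        gcongr
        exact hB _ (by positivity)

/-- A Clarkson–Shor estimate: if at most `M * (#S + #Nᶜ) ^ d` of the configurations `T` are
compatible with any sample `S`, then for some sample of rate `t / n` the moments of the rescaled
conflict lists of the compatible configurations sum up to `O(t ^ d)`. -/
lemma exists_sample_sum_le (a b d e : ℕ) :
    ∃ B : ℝ, 0 < B ∧ ∀ {ι X : Type*} [Fintype ι] (N : Finset ι) (T : Finset X)
      (D K : X → Finset ι) (M t : ℝ), Nᶜ.card ≤ a → (∀ c ∈ T, D c ⊆ N) → (∀ c ∈ T, K c ⊆ N) →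
      (∀ c ∈ T, Disjoint (D c) (K c)) → (∀ c ∈ T, (D c).card ≤ b) → 0 ≤ M →
      (∀ S ⊆ N, ((T.filter fun c => D c ⊆ S ∧ Disjoint S (K c)).card : ℝ) ≤
        M * (S.card + Nᶜ.card) ^ d) →
      1 ≤ t → t ≤ Fintype.card ι →
      ∃ S ⊆ N, ∑ c ∈ T with D c ⊆ S ∧ Disjoint S (K c),
        (1 + (K c).card / (Fintype.card ι / t)) ^ e ≤ M * B * t ^ d := by
  obtain ⟨B, hB0, hB⟩ := exists_add_one_pow_mul_exp_le e
  refine ⟨2 ^ b * B * (d + a + 1) ^ d, by positivity, ?_⟩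
  intro ι X _ N T D K M t hN hDN hKN hDK hDb hM hT ht1 htn
  set n : ℝ := (Fintype.card ι : ℝ)
  have hn : 0 < n := by linarith
  set p := t / n with hp
  have hp0 : 0 ≤ p := div_nonneg (by linarith) hn.le
  have hp1 : p ≤ 1 := (div_le_one hn).2 htn
  refine exists_of_sum_sampleWeight_le hp0 hp1 (N := N) ?_
  rw [sum_sampleWeight_mul_sum_filter p N T D K hDN hKN hDK]
  have hNn : (N.card : ℝ) ≤ n := Nat.cast_le.2 (Finset.card_le_univ N)
  have hNa : (Nᶜ.card : ℝ) ≤ a := by exact_mod_cast hN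
  calc ∑ c ∈ T, (1 + (K c).card / (n / t)) ^ e * (p ^ (D c).card * (1 - p) ^ (K c).card)
      ≤ ∑ c ∈ T, 2 ^ b * B * ((p / 2) ^ (D c).card * (1 - p / 2) ^ (K c).card) := by
        refine Finset.sum_le_sum fun c hc => ?_
        have h1 := one_add_mul_pow_mul_le hB hp0 hp1 (K c).card
        have h2 : p ^ (D c).card ≤ 2 ^ b * (p / 2) ^ (D c).card := by
          calc p ^ (D c).card = 2 ^ (D c).card * (p / 2) ^ (D c).card := by
                rw [← mul_pow]
                ring_nf
            _ ≤ _ := by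
                gcongr
                · norm_num
                · exact hDb c hc
        have h3 : ((K c).card : ℝ) / (n / t) = (K c).card * p := by
          rw [hp]
          field_simp
        have h5 : 0 ≤ 1 - p := by linarith
        rw [h3]
        calc (1 + (K c).card * p) ^ e * (p ^ (D c).card * (1 - p) ^ (K c).card)
            = p ^ (D c).card * ((1 + (K c).card * p) ^ e * (1 - p) ^ (K c).card) := by ring
          _ ≤ (2 ^ b * (p / 2) ^ (D c).card) * (B * (1 - p / 2) ^ (K c).card) :=
              mul_le_mul h2 h1 (by positivity) (by positivity)
          _ = _ := by ring
    _ = 2 ^ b * B * ∑ S ∈ N.powerset, sampleWeight (p / 2) N S *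
          ∑ c ∈ T with D c ⊆ S ∧ Disjoint S (K c), (1 : ℝ) := by
        rw [sum_sampleWeight_mul_sum_filter (p / 2) N T D K hDN hKN hDK, Finset.mul_sum]
        simp
    _ ≤ 2 ^ b * B * ∑ S ∈ N.powerset, M * (sampleWeight (p / 2) N S *
          ((S.card : ℝ) + Nᶜ.card) ^ d) := by
        refine mul_le_mul_of_nonneg_left (Finset.sum_le_sum fun S hS => ?_) (by positivity)
        rw [Finset.sum_const, nsmul_eq_mul, mul_one, mul_left_comm]
        exact mul_le_mul_of_nonneg_left (hT S (Finset.mem_powerset.1 hS))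
          (sampleWeight_nonneg (by linarith) (by linarith) N S)
    _ ≤ 2 ^ b * B * (M * (d + Nᶜ.card + p / 2 * N.card) ^ d) := by
        rw [← Finset.mul_sum]
        gcongr
        exact sum_sampleWeight_mul_card_pow_le (by linarith) N d
    _ ≤ 2 ^ b * B * (M * ((d + a + 1) * t) ^ d) := by
        have h6 : p / 2 * N.card ≤ t := by
          calc p / 2 * N.card ≤ p * n := by gcongr; linarith
            _ = t := div_mul_cancel₀ _ hn.ne'
        have h7 : ((d : ℝ) + a) * 1 ≤ (d + a) * t := by gcongr
        gcongr
        linarith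
    _ = M * (2 ^ b * B * (d + a + 1) ^ d) * t ^ d := by
        rw [mul_pow]
        ring

end ClarksonShor

section Cutting

lemma exists_weak_cutting_of_linearIndependent {d : ℕ} (hd : 1 ≤ d) :
    ∃ C : ℝ, 0 < C ∧ ∀ {V ι : Type*} [AddCommGroup V] [Module ℝ V] [Fintype ι]
      (φ : ι → Module.Dual ℝ V) (f : Fin (d + 1) → V), Module.finrank ℝ V = d + 1 →
      LinearIndependent ℝ f → ∀ m : ℝ, 0 < m →
      ∃ Q : Finset V, (Q.card : ℝ) ≤ C * (1 + (crossing φ f).card / m) ^ (2 * d) ∧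
        ∀ t : Fin (d + 1) → ℝ, (∀ j, 0 ≤ t j) →
          ∃ (q : Fin (d + 1) → V) (w : Fin (d + 1) → ℝ), (∀ i, q i ∈ Q) ∧ (∀ i, 0 ≤ w i) ∧
            ∑ j, t j • f j = ∑ i, w i • q i ∧ ((crossing φ q).card : ℝ) ≤ m := by
  obtain ⟨C, hC, hcut⟩ := exists_weak_cutting hd
  refine ⟨C, hC, ?_⟩
  intro V ι _ _ _ φ f hV hf m hm
  let x := basisOfLinearIndependentOfCardEqFinrank hf (by simp [hV])
  have hx : ∀ i, x i = f i := fun i => by simp [x]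
  obtain ⟨Q, hQ, hQx, hQc⟩ := hcut (fun k : {k // k ∈ crossing φ f} => φ k) x m hm
  rw [Fintype.card_coe] at hQ
  refine ⟨Q, hQ, fun t ht => ?_⟩
  obtain ⟨q, w, hqQ, hw, hsum, hcard⟩ := hQc (∑ j, t j • f j) fun i => by
    simp only [← hx, map_sum, map_smul, Module.Basis.coord_apply, x.repr_self]
    simp [Finsupp.single_apply, ht]
  refine ⟨q, w, hqQ, hw, hsum, le_trans ?_ hcard⟩
  have hsub : crossing φ q ⊆ (Finset.univ.filter fun k : {k // k ∈ crossing φ f} =>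
      ∃ i j, φ k (q i) < 0 ∧ 0 < φ k (q j)).map (Function.Embedding.subtype _) := by
    intro k hk
    obtain ⟨-, i, j, hi, hj⟩ := Finset.mem_filter.1 hk
    by_cases hkf : k ∈ crossing φ f
    · exact Finset.mem_map.2 ⟨⟨k, hkf⟩, Finset.mem_filter.2 ⟨Finset.mem_univ _, i, j, hi, hj⟩, rfl⟩
    · exfalso
      have hexp : ∀ g, φ k g = ∑ l, x.coord l g * φ k (f l) := fun g => by
        conv_lhs => rw [← x.sum_repr g]
        simp [hx]
      refine (mul_neg_of_neg_of_pos hi hj).not_ge ?_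
      rw [hexp, hexp (q j), Finset.sum_mul_sum]
      refine Finset.sum_nonneg fun a _ => Finset.sum_nonneg fun b _ => ?_
      rw [mul_mul_mul_comm]
      exact mul_nonneg (mul_nonneg (hQx _ (hqQ i) a) (hQx _ (hqQ j) b))
        (mul_nonneg_of_notMem_crossing hkf a b)
  exact_mod_cast (Finset.card_le_card hsub).trans (Finset.card_map _).le

/-- Existence of cuttings of optimal size, with cells the cones spanned by `d + 1` vectors of a
common finite set, off finitely many proper subspaces. -/
lemma exists_cutting {d : ℕ} (hd : 1 ≤ d) :
    ∃ C : ℝ, 0 < C ∧ ∀ {V ι : Type*} [AddCommGroup V] [Module ℝ V] [FiniteDimensional ℝ V]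
      [Fintype ι] (φ : ι → Module.Dual ℝ V), Module.finrank ℝ V = d + 1 → (∀ i, φ i ≠ 0) →
      (∀ g : V, g ≠ 0 → (Finset.univ.filter fun i => φ i g = 0).card ≤ d) →
      d + 1 ≤ Fintype.card ι → ∀ t : ℝ, 1 ≤ t → t ≤ Fintype.card ι →
      ∃ Q : Finset V, (Q.card : ℝ) ≤ C * t ^ d ∧
        ∃ W : Finset (Submodule ℝ V), (∀ w ∈ W, w ≠ ⊤) ∧ ∀ h, (∀ w ∈ W, h ∉ w) →
          ∃ (q : Fin (d + 1) → V) (w : Fin (d + 1) → ℝ), (∀ i, q i ∈ Q) ∧ (∀ i, 0 ≤ w i) ∧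
            h = ∑ i, w i • q i ∧ ((crossing φ q).card : ℝ) ≤ Fintype.card ι / t := by
  obtain ⟨C, hC, hcut⟩ := exists_weak_cutting_of_linearIndependent hd
  obtain ⟨B, hB, hsample⟩ := exists_sample_sum_le (d + 1) ((d + 1) * d) d (2 * d)
  refine ⟨C * (3 ^ (d + (d + 1)) * B), by positivity, ?_⟩
  intro V ι _ _ _ _ φ hV hφ0 hφ hcard t ht1 htn
  obtain ⟨A, -, hA⟩ := Finset.exists_subset_card_eq
    (s := (Finset.univ : Finset ι)) (n := d + 1) (by simpa using hcard)
  have hfin := finite_tightRays hφ hA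
  obtain ⟨u, hu⟩ := exists_dual_injOn hfin
  let T : Finset ((Fin (d + 1) → V) × (Fin d → ι)) :=
    ((Fintype.piFinset fun _ => hfin.toFinset) ×ˢ Finset.univ).filter fun c =>
      IsMinSimplex φ A u c.1 c.2
  have hT : ∀ f p, (f, p) ∈ T ↔ IsMinSimplex φ A u f p := by
    intro f p
    simp only [T, Finset.mem_filter, Finset.mem_product, Fintype.mem_piFinset, Set.Finite.mem_toFinset,
      Finset.mem_univ, and_true, and_iff_right_iff_imp]
    exact fun h i => h.mem_tightRays i
  have hm : 0 < (Fintype.card ι : ℝ) / t := by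
    have : (0 : ℝ) < Fintype.card ι := by linarith
    exact div_pos this (by linarith)
  obtain ⟨S, hSN, hS⟩ := hsample Aᶜ T (fun c => touching φ A c.1) (fun c => crossing φ c.1)
    (3 ^ (d + (d + 1))) t (by rw [compl_compl, hA])
    (fun c _ q hq => Finset.mem_compl.2 (Finset.mem_filter.1 hq).2.1)
    (fun c hc q hq => Finset.mem_compl.2 fun hqA =>
      ((hT _ _).1 hc).notMem_crossing q (Finset.mem_union_left _ hqA) hq)
    (fun c hc => Finset.disjoint_left.2 fun q hq =>
      ((hT _ _).1 hc).notMem_crossing q (Finset.mem_union_right _ hq))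
    (fun c hc => card_touching_le hφ fun i =>
      ne_zero_of_mem_tightRays (((hT _ _).1 hc).mem_tightRays i))
    (by positivity)
    (fun S _ => by
      rw [compl_compl, hA]
      exact_mod_cast card_isMinSimplex_le hφ hA hu _ fun c hc =>
        ⟨(hT _ _).1 (Finset.mem_filter.1 hc).1, (Finset.mem_filter.1 hc).2⟩)
    ht1 htn
  have hex : ∀ c : (Fin (d + 1) → V) × (Fin d → ι), ∃ Q : Finset V, c ∈ T →
      (Q.card : ℝ) ≤ C * (1 + (crossing φ c.1).card / (Fintype.card ι / t)) ^ (2 * d) ∧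
        ∀ s : Fin (d + 1) → ℝ, (∀ j, 0 ≤ s j) →
          ∃ (q : Fin (d + 1) → V) (w : Fin (d + 1) → ℝ), (∀ i, q i ∈ Q) ∧ (∀ i, 0 ≤ w i) ∧
            ∑ j, s j • c.1 j = ∑ i, w i • q i ∧
            ((crossing φ q).card : ℝ) ≤ Fintype.card ι / t := by
    intro c
    by_cases hc : c ∈ T
    · obtain ⟨Q, hQ⟩ := hcut φ c.1 hV ((hT _ _).1 hc).linearIndependent _ hm
      exact ⟨Q, fun _ => hQ⟩
    · exact ⟨∅, fun h => absurd h hc⟩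
  choose Q hQ using hex
  refine ⟨(T.filter fun c => touching φ A c.1 ⊆ S ∧ Disjoint S (crossing φ c.1)).biUnion Q, ?_,
    (hfin.toFinset.powerset.image fun s : Finset V =>
      Submodule.span ℝ (s : Set V)).filter (· ≠ ⊤),
    fun w hw => (Finset.mem_filter.1 hw).2, fun h hh => ?_⟩
  · calc _ ≤ ((∑ c ∈ T with touching φ A c.1 ⊆ S ∧ Disjoint S (crossing φ c.1),
            (Q c).card : ℕ) : ℝ) := by exact_mod_cast Finset.card_biUnion_le
      _ ≤ ∑ c ∈ T with touching φ A c.1 ⊆ S ∧ Disjoint S (crossing φ c.1),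
            C * (1 + (crossing φ c.1).card / (Fintype.card ι / t)) ^ (2 * d) := by
          rw [Nat.cast_sum]
          exact Finset.sum_le_sum fun c hc => (hQ c (Finset.mem_filter.1 hc).1).1
      _ ≤ C * (3 ^ (d + (d + 1)) * B * t ^ d) := by
          rw [← Finset.mul_sum]
          exact mul_le_mul_of_nonneg_left hS hC.le
      _ = _ := by ring
  · obtain ⟨f, p, s, hfp, hfS, hSf, hs, rfl⟩ := exists_isMinSimplex hV hφ0 hφ hA u S (h := h)
      fun r hr hrt => hh _ (Finset.mem_filter.2 ⟨Finset.mem_image.2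
        ⟨(hfin.subset hr).toFinset, Finset.mem_powerset.2 fun v hv => by
          simpa using hr (by simpa using hv), by simp⟩, hrt⟩)
    have hc := (hT f p).2 hfp
    obtain ⟨q, w, hq, hw, hsum, hqc⟩ := (hQ _ hc).2 s hs
    exact ⟨q, w, fun i => Finset.mem_biUnion.2
      ⟨_, Finset.mem_filter.2 ⟨hc, hfS, hSf⟩, hq i⟩, hw, hsum, hqc⟩

end Cutting

section AffineFunctions

variable {d : ℕ}

/-- Evaluation at `x` of the affine function `⟪·, g.1⟫ - g.2`. -/
def affineEval (x : EuclideanSpace ℝ (Fin d)) : Module.Dual ℝ (EuclideanSpace ℝ (Fin d) × ℝ) :=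
  (innerSL ℝ x).toLinearMap ∘ₗ LinearMap.fst ℝ _ ℝ - LinearMap.snd ℝ _ ℝ

lemma affineEval_apply (x : EuclideanSpace ℝ (Fin d)) (g : EuclideanSpace ℝ (Fin d) × ℝ) :
    affineEval x g = ⟪x, g.1⟫ - g.2 := by
  simp [affineEval]

lemma affineEval_eq_zero_iff (x : EuclideanSpace ℝ (Fin d)) (g : EuclideanSpace ℝ (Fin d) × ℝ) :
    affineEval x g = 0 ↔ x ∈ hyperplane g.1 g.2 := by
  rw [affineEval_apply, sub_eq_zero]
  rfl

lemma affineEval_ne_zero (x : EuclideanSpace ℝ (Fin d)) : affineEval x ≠ 0 := by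
  intro h
  simpa [affineEval_apply] using LinearMap.congr_fun h (0, 1)

lemma continuous_affineEval (g : EuclideanSpace ℝ (Fin d) × ℝ) :
    Continuous fun x => affineEval x g := by
  simp only [affineEval_apply]
  fun_prop

lemma GenPos.card_filter_affineEval_le {P : Finset (EuclideanSpace ℝ (Fin d))} (hP : GenPos P)
    {g : EuclideanSpace ℝ (Fin d) × ℝ} (hg : g ≠ 0) :
    (Finset.univ.filter fun p : P => affineEval (p : EuclideanSpace ℝ (Fin d)) g = 0).card ≤ d := by
  by_cases ha : g.1 = 0
  · have hb : g.2 ≠ 0 := fun hb => hg (Prod.ext ha hb)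
    simp [affineEval_apply, ha, hb]
  · refine le_trans ?_ (hP g.1 g.2 ha)
    rw [← Finset.card_map (Function.Embedding.subtype _), ← Set.ncard_coe_finset]
    refine Set.ncard_le_ncard ?_ (P.finite_toSet.subset Set.inter_subset_left)
    intro x hx
    obtain ⟨p, hp, rfl⟩ := Finset.mem_map.1 (Finset.mem_coe.1 hx)
    exact ⟨p.2, (affineEval_eq_zero_iff _ _).1 (Finset.mem_filter.1 hp).2⟩

lemma exists_affineEval_neg_pos {s : Set (EuclideanSpace ℝ (Fin d))} (hs : IsOpen s)
    {a : EuclideanSpace ℝ (Fin d)} {b : ℝ} (ha : a ≠ 0) (h : (hyperplane a b ∩ s).Nonempty) :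
    ∃ y ∈ s, ∃ z ∈ s, affineEval y (a, b) < 0 ∧ 0 < affineEval z (a, b) := by
  obtain ⟨x, hx, hxs⟩ := h
  have hx0 := (affineEval_eq_zero_iff x (a, b)).2 hx
  have hline : ∀ c : ℝ, affineEval (x + c • a) (a, b) = c * ‖a‖ ^ 2 := by
    intro c
    rw [affineEval_apply] at hx0 ⊢
    rw [inner_add_left, real_inner_smul_left, real_inner_self_eq_norm_sq]
    linarith
  have hnear : ∀ᶠ c : ℝ in nhds 0, x + c • a ∈ s := by
    have hc : Continuous fun c : ℝ => x + c • a := by fun_prop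
    exact hc.continuousAt.eventually_mem (hs.mem_nhds (by simpa using hxs))
  obtain ⟨ε, hε, hball⟩ := Metric.eventually_nhds_iff.1 hnear
  have ha2 : 0 < ‖a‖ ^ 2 := by positivity
  refine ⟨x + (-(ε / 2)) • a, hball ?_, x + (ε / 2) • a, hball ?_, ?_, ?_⟩
  · rw [Real.dist_0_eq_abs, abs_neg, abs_of_pos (by linarith)]
    linarith
  · rw [Real.dist_0_eq_abs, abs_of_pos (by linarith)]
    linarith
  · rw [hline]
    nlinarith
  · rw [hline]
    positivity

lemma sign_affineEval_eq {s : Set (EuclideanSpace ℝ (Fin d))} (hs : Convex ℝ s)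
    {g : EuclideanSpace ℝ (Fin d) × ℝ} (h : g.1 ≠ 0 → ¬ (hyperplane g.1 g.2 ∩ s).Nonempty)
    {x y : EuclideanSpace ℝ (Fin d)} (hx : x ∈ s) (hy : y ∈ s) :
    SignType.sign (affineEval x g) = SignType.sign (affineEval y g) := by
  by_cases hg : g.1 = 0
  · simp [affineEval_apply, hg]
  · have hne : ∀ z ∈ s, affineEval z g ≠ 0 := fun z hz h0 =>
      h hg ⟨z, (affineEval_eq_zero_iff z g).1 h0, hz⟩
    have hivt : ∀ y z, y ∈ s → z ∈ s → affineEval y g < 0 → 0 < affineEval z g → False := by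
      intro y z hy hz h1 h2
      obtain ⟨w, hw, hw0⟩ := hs.isPreconnected.intermediate_value hy hz
        (continuous_affineEval g).continuousOn ⟨h1.le, h2.le⟩
      exact hne w hw hw0
    rcases lt_or_gt_of_ne (hne x hx) with h1 | h1 <;> rcases lt_or_gt_of_ne (hne y hy) with h2 | h2
    · rw [sign_neg h1, sign_neg h2]
    · exact (hivt x y hx hy h1 h2).elim
    · exact (hivt y x hy hx h2 h1).elim
    · rw [sign_pos h1, sign_pos h2]

lemma exists_neg_pos_of_affineEval_sum {n : ℕ} {s : Set (EuclideanSpace ℝ (Fin d))}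
    (hs : Convex ℝ s) {q : Fin n → EuclideanSpace ℝ (Fin d) × ℝ}
    (hq : ∀ i, (q i).1 ≠ 0 → ¬ (hyperplane (q i).1 (q i).2 ∩ s).Nonempty)
    {w : Fin n → ℝ} (hw : ∀ i, 0 ≤ w i) {x y z : EuclideanSpace ℝ (Fin d)} (hx : x ∈ s)
    (hy : y ∈ s) (hz : z ∈ s) (hyn : affineEval y (∑ i, w i • q i) < 0)
    (hzp : 0 < affineEval z (∑ i, w i • q i)) :
    ∃ i j, affineEval x (q i) < 0 ∧ 0 < affineEval x (q j) := by
  rw [map_sum] at hyn hzp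
  obtain ⟨i, -, hi⟩ := Finset.exists_lt_of_sum_lt (g := fun _ => (0 : ℝ))
    (by simpa only [Finset.sum_const_zero] using hyn)
  obtain ⟨j, -, hj⟩ := Finset.exists_lt_of_sum_lt (f := fun _ => (0 : ℝ))
    (by simpa only [Finset.sum_const_zero] using hzp)
  rw [map_smul, smul_eq_mul] at hi hj
  refine ⟨i, j, ?_, ?_⟩
  · rw [← sign_eq_neg_one_iff, sign_affineEval_eq hs (hq i) hx hy, sign_eq_neg_one_iff]
    by_contra hcon
    exact hi.not_ge (mul_nonneg (hw i) (not_lt.1 hcon))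
  · rw [← sign_eq_one_iff, sign_affineEval_eq hs (hq j) hx hz, sign_eq_one_iff]
    exact pos_of_mul_pos_right hj (hw j)

end AffineFunctions

lemma exists_notMem_of_forall_ne_zero {V κ : Type*} [AddCommGroup V] [Module ℝ V] [Finite κ]
    (W : Finset (Submodule ℝ V)) (hW : ∀ w ∈ W, w ≠ ⊤) (ψ : κ → Module.Dual ℝ V) (h : V)
    (hψ : ∀ k, 0 < ψ k h) : ∃ h', (∀ w ∈ W, h' ∉ w) ∧ ∀ k, 0 < ψ k h' := by
  obtain ⟨v, hv⟩ : ∃ v : V, ∀ w ∈ W, v ∉ w := by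
    have := Subspace.biUnion_ne_univ_of_top_notMem (s := W) fun hmem => hW _ hmem rfl
    simpa [Set.ne_univ_iff_exists_notMem] using this
  have h1 : ∀ᶠ c : ℝ in nhdsWithin 0 (Set.Ioi 0), ∀ w ∈ W, h + c • v ∉ w := by
    refine (Filter.eventually_all_finset W).2 fun w hw => ?_
    have hsub : {c : ℝ | h + c • v ∈ w}.Subsingleton := by
      intro c hc c' hc'
      by_contra hne
      have : (c - c') • v ∈ w := by
        have := w.sub_mem hc hc'
        rwa [add_sub_add_left_eq_sub, ← sub_smul] at this
      exact hv w hw ((w.smul_mem_iff (sub_ne_zero.2 hne)).1 this)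
    have hcl : ({c : ℝ | h + c • v ∈ w} \ {0})ᶜ ∈ nhds (0 : ℝ) :=
      (hsub.finite.subset Set.sdiff_subset).isClosed.isOpen_compl.mem_nhds (by simp)
    filter_upwards [nhdsWithin_le_nhds hcl, self_mem_nhdsWithin] with c hc hc0 hcw
    exact hc ⟨hcw, (Set.mem_Ioi.1 hc0).ne'⟩
  have h2 : ∀ᶠ c : ℝ in nhdsWithin 0 (Set.Ioi 0), ∀ k, 0 < ψ k (h + c • v) := by
    refine Filter.eventually_all.2 fun k => nhdsWithin_le_nhds ?_
    have hc : Continuous fun c : ℝ => ψ k (h + c • v) := by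
      simp only [map_add, map_smul]
      fun_prop
    exact hc.continuousAt.eventually (lt_mem_nhds (by simpa using hψ k))
  obtain ⟨c, hc1, hc2⟩ := (h1.and h2).exists
  exact ⟨_, hc1, hc2⟩

section TestSet

variable {d m : ℕ}

/-- The number of members of a family of open simplices met by a hyperplane. -/
def meetCount (Δ : Fin m → Set (EuclideanSpace ℝ (Fin d))) (g : EuclideanSpace ℝ (Fin d) × ℝ) : ℕ :=
  {i : Fin m | (hyperplane g.1 g.2 ∩ Δ i).Nonempty}.ncard

lemma IsOpenSimplex.isOpen {s : Set (EuclideanSpace ℝ (Fin d))} (hs : IsOpenSimplex s) :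
    IsOpen s := by
  obtain ⟨v, -, rfl⟩ := hs
  exact isOpen_interior

lemma IsOpenSimplex.convex {s : Set (EuclideanSpace ℝ (Fin d))} (hs : IsOpenSimplex s) :
    Convex ℝ s := by
  obtain ⟨v, -, rfl⟩ := hs
  exact (convex_convexHull ℝ _).interior

lemma card_mul_le_of_pairwiseDisjoint {α : Type*} {parts : Fin m → Finset α}
    (hdisj : ∀ i j, i ≠ j → Disjoint (parts i) (parts j)) {k : ℕ} (hk : ∀ i, k ≤ (parts i).card)
    {J : Finset (Fin m)} {s : Finset α} (hJ : ∀ i ∈ J, parts i ⊆ s) : J.card * k ≤ s.card := by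
  calc J.card * k ≤ ∑ i ∈ J, (parts i).card := by
        simpa using Finset.card_nsmul_le_sum J (fun i => (parts i).card) k fun i _ => hk i
    _ = (J.biUnion parts).card := (Finset.card_biUnion fun i _ j _ hij => hdisj i j hij).symm
    _ ≤ s.card := Finset.card_le_card (Finset.biUnion_subset.2 hJ)

/-- A cutting bounds the number of simplices met by an arbitrary hyperplane in terms of the numbers
of simplices met by its vertices. -/
lemma meetCount_le {P : Finset (EuclideanSpace ℝ (Fin d))} {k : ℕ} (hk : 1 ≤ k)
    {parts : Fin m → Finset (EuclideanSpace ℝ (Fin d))}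
    {Δ : Fin m → Set (EuclideanSpace ℝ (Fin d))}
    (hdisj : ∀ i j, i ≠ j → Disjoint (parts i) (parts j)) (hP : ∀ i, parts i ⊆ P)
    (hcard : ∀ i, k ≤ (parts i).card) (hΔ : ∀ i, IsOpenSimplex (Δ i))
    (hparts : ∀ i, ↑(parts i) ⊆ Δ i) {Q : Finset (EuclideanSpace ℝ (Fin d) × ℝ)}
    {W : Finset (Submodule ℝ (EuclideanSpace ℝ (Fin d) × ℝ))} (hW : ∀ w ∈ W, w ≠ ⊤) {μ : ℝ}
    (hQ : ∀ h, (∀ w ∈ W, h ∉ w) →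
      ∃ (q : Fin (d + 1) → EuclideanSpace ℝ (Fin d) × ℝ) (w : Fin (d + 1) → ℝ),
        (∀ i, q i ∈ Q) ∧ (∀ i, 0 ≤ w i) ∧ h = ∑ i, w i • q i ∧
        ((crossing (fun p : P => affineEval (p : EuclideanSpace ℝ (Fin d))) q).card : ℝ) ≤ μ)
    {κ₀ : ℝ} (hκ₀ : 0 ≤ κ₀) (hmeet : ∀ q ∈ Q, q.1 ≠ 0 → (meetCount Δ q : ℝ) ≤ κ₀)
    {a : EuclideanSpace ℝ (Fin d)} (b : ℝ) (ha : a ≠ 0) :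
    (meetCount Δ (a, b) : ℝ) ≤ (d + 1) * κ₀ + μ / k := by
  let I : Set (Fin m) := {i | (hyperplane a b ∩ Δ i).Nonempty}
  choose y hy z hz hyn hzp using fun i : I =>
    exists_affineEval_neg_pos (hΔ i).isOpen ha i.2
  obtain ⟨h', hh'W, hh'⟩ := exists_notMem_of_forall_ne_zero W hW
    (Sum.elim (fun i => -affineEval (y i)) fun i => affineEval (z i)) (a, b) (by
      rintro (i | i)
      · simpa using hyn i
      · exact hzp i)
  obtain ⟨q, w, hqQ, hw, rfl, hcross⟩ := hQ h' hh'W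
  set Kc := (crossing (fun p : P => affineEval (p : EuclideanSpace ℝ (Fin d))) q).map
    (Function.Embedding.subtype _) with hKc
  let J : Finset (Fin m) := Finset.univ.filter fun i => parts i ⊆ Kc
  let M : Fin (d + 1) → Finset (Fin m) := fun j => Finset.univ.filter fun i =>
    (q j).1 ≠ 0 ∧ (hyperplane (q j).1 (q j).2 ∩ Δ i).Nonempty
  have hsub : I ⊆ ↑(Finset.univ.biUnion M ∪ J) := by
    intro i hi
    by_cases hM : ∃ j, (q j).1 ≠ 0 ∧ (hyperplane (q j).1 (q j).2 ∩ Δ i).Nonempty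
    · exact Finset.mem_union_left _ (by simpa [M] using hM)
    · refine Finset.mem_union_right _ (Finset.mem_filter.2 ⟨Finset.mem_univ _, fun x hx => ?_⟩)
      push Not at hM
      obtain ⟨l, j, hl, hj⟩ := exists_neg_pos_of_affineEval_sum (hΔ i).convex
        (fun j hj => Set.not_nonempty_iff_eq_empty.2 (hM j hj)) hw (hparts i hx)
        (hy ⟨i, hi⟩) (hz ⟨i, hi⟩) (by simpa using hh' (Sum.inl ⟨i, hi⟩))
        (hh' (Sum.inr ⟨i, hi⟩))
      exact Finset.mem_map.2 ⟨⟨x, hP i hx⟩,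
        Finset.mem_filter.2 ⟨Finset.mem_univ _, l, j, hl, hj⟩, rfl⟩
  have hMcard : ∀ j, ((M j).card : ℝ) ≤ κ₀ := by
    intro j
    by_cases hj : (q j).1 = 0
    · simpa [M, hj] using hκ₀
    · refine le_trans ?_ (hmeet _ (hqQ j) hj)
      rw [meetCount, Nat.cast_le, ← Set.ncard_coe_finset]
      exact Set.ncard_le_ncard (fun i hi => (Finset.mem_filter.1 hi).2.2) (Set.toFinite _)
  have hJcard : (J.card : ℝ) ≤ μ / k := by
    have hk0 : (0 : ℝ) < k := by exact_mod_cast hk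
    rw [le_div_iff₀ hk0]
    refine le_trans ?_ hcross
    rw [← Finset.card_map (Function.Embedding.subtype _), ← hKc]
    exact_mod_cast card_mul_le_of_pairwiseDisjoint hdisj hcard
      fun i hi => (Finset.mem_filter.1 hi).2
  calc (meetCount Δ (a, b) : ℝ) ≤ ((Finset.univ.biUnion M ∪ J).card : ℕ) := by
        rw [Nat.cast_le, ← Set.ncard_coe_finset]
        exact Set.ncard_le_ncard hsub (Finset.finite_toSet _)
    _ ≤ ((∑ j, (M j).card : ℕ) : ℝ) + J.card := by
        exact_mod_cast (Finset.card_union_le _ _).trans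
          (Nat.add_le_add_right Finset.card_biUnion_le _)
    _ ≤ (d + 1) * κ₀ + μ / k := by
        rw [Nat.cast_sum]
        refine add_le_add ((Finset.sum_le_card_nsmul _ _ κ₀ fun j _ => hMcard j).trans ?_) hJcard
        simp

end TestSet

/-- Lemma 4.5, Test-set Lemma, `d ≥ 3`. -/
theorem test_set_lemma (d : ℕ) (hd : 3 ≤ d) :
    ∃ C : ℝ, 0 < C ∧
      ∀ (P : Finset (EuclideanSpace ℝ (Fin d))) (n k : ℕ),
        P.card = n → 1 ≤ k → k ≤ n → GenPos P →
        ∃ Q : Finset (EuclideanSpace ℝ (Fin d) × ℝ),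
          (∀ q ∈ Q, q.1 ≠ 0) ∧
          (Q.card : ℝ) ≤ C * ((n : ℝ) / k) ^ ((d : ℝ) / ((d : ℝ) - 1)) ∧
          ∀ (m : ℕ) (parts : Fin m → Finset (EuclideanSpace ℝ (Fin d)))
            (Δ : Fin m → Set (EuclideanSpace ℝ (Fin d))),
            (∀ i j, i ≠ j → Disjoint (parts i) (parts j)) →
            (∀ p, p ∈ P ↔ ∃ i, p ∈ parts i) →
            (∀ i, k ≤ (parts i).card) →
            (∀ i, IsOpenSimplex (Δ i)) →
            (∀ i, ↑(parts i) ⊆ Δ i) →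
            ∀ κ₀ : ℝ,
              (∀ q ∈ Q,
                (({i : Fin m | (hyperplane q.1 q.2 ∩ Δ i).Nonempty}.ncard : ℝ) ≤ κ₀)) →
              ∀ (a : EuclideanSpace ℝ (Fin d)) (b : ℝ), a ≠ 0 →
                (({i : Fin m | (hyperplane a b ∩ Δ i).Nonempty}.ncard : ℝ)
                  ≤ ((d : ℝ) + 1) * κ₀ +
                      C * ((n : ℝ) / k) ^ (1 - 1 / ((d : ℝ) - 1))) := by
  obtain ⟨C, hC, hcut⟩ := exists_cutting (d := d) (by omega)
  refine ⟨C + 1 + d, by positivity, ?_⟩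
  intro P n k hPn hk hkn hP
  have hk0 : (0 : ℝ) < k := by exact_mod_cast hk
  have hr : 1 ≤ (n : ℝ) / k := (one_le_div hk0).2 (by exact_mod_cast hkn)
  have hrn : (n : ℝ) / k ≤ n := div_le_self (Nat.cast_nonneg n) (by exact_mod_cast hk)
  have hd3 : (3 : ℝ) ≤ d := by exact_mod_cast hd
  set r := (n : ℝ) / k with hrdef
  have hr0 : 0 < r := by linarith
  have he : 0 ≤ 1 - 1 / ((d : ℝ) - 1) := by
    rw [sub_nonneg, div_le_one (by linarith)]
    linarith
  have hpow1 : 1 ≤ r ^ ((d : ℝ) / ((d : ℝ) - 1)) :=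
    Real.one_le_rpow hr (div_nonneg (by linarith) (by linarith))
  have hpow2 : 1 ≤ r ^ (1 - 1 / ((d : ℝ) - 1)) := Real.one_le_rpow hr he
  obtain ⟨e, he0⟩ : ∃ e : EuclideanSpace ℝ (Fin d), e ≠ 0 := by
    have : Nonempty (Fin d) := ⟨⟨0, by omega⟩⟩
    exact exists_ne 0
  rcases Nat.lt_or_ge n (d + 1) with hnd | hnd
  · refine ⟨{(e, 0)}, by simpa using he0, ?_, ?_⟩
    · rw [Finset.card_singleton, Nat.cast_one]
      nlinarith
    · intro m parts Δ hdisj hparts hcard hΔ hsub κ₀ hκ₀ a b ha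
      have hκ : 0 ≤ κ₀ := le_trans (Nat.cast_nonneg _) (hκ₀ _ (Finset.mem_singleton_self _))
      have hm : m * k ≤ n := by
        have := card_mul_le_of_pairwiseDisjoint hdisj hcard (J := Finset.univ) (s := P)
          fun i _ p hp => (hparts p).2 ⟨i, hp⟩
        rwa [Finset.card_univ, Fintype.card_fin, hPn] at this
      have hmd : m ≤ d := by nlinarith
      have hle : {i : Fin m | (hyperplane a b ∩ Δ i).Nonempty}.ncard ≤ m := by
        simpa using Set.ncard_le_card {i : Fin m | (hyperplane a b ∩ Δ i).Nonempty}
      have h1 : ({i : Fin m | (hyperplane a b ∩ Δ i).Nonempty}.ncard : ℝ) ≤ d := by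
        exact_mod_cast hle.trans hmd
      have h2 : 0 ≤ ((d : ℝ) + 1) * κ₀ := by positivity
      nlinarith
  · set t := r ^ (1 / ((d : ℝ) - 1)) with ht
    have ht1 : 1 ≤ t := Real.one_le_rpow hr (div_nonneg zero_le_one (by linarith))
    have htr : t ≤ r := by
      conv_rhs => rw [← Real.rpow_one r]
      exact Real.rpow_le_rpow_of_exponent_le hr (by linarith)
    have htd : t ^ d = r ^ ((d : ℝ) / ((d : ℝ) - 1)) := by
      rw [ht, ← Real.rpow_natCast, ← Real.rpow_mul hr0.le]
      ring_nf
    have hcard : Fintype.card P = n := by rw [Fintype.card_coe, hPn]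
    have hdiv : (n : ℝ) / t / k = r ^ (1 - 1 / ((d : ℝ) - 1)) := by
      rw [Real.rpow_sub hr0, Real.rpow_one, ← ht, hrdef]
      ring
    obtain ⟨Q, hQ, W, hW, hQW⟩ := hcut (fun p : P => affineEval (p : EuclideanSpace ℝ (Fin d)))
      (by simp) (fun p => affineEval_ne_zero _) (fun g hg => hP.card_filter_affineEval_le hg)
      (by rwa [hcard]) t ht1 (by rw [hcard]; exact htr.trans hrn)
    refine ⟨insert (e, 0) (Q.filter fun q => q.1 ≠ 0), ?_, ?_, ?_⟩
    · intro q hq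
      rcases Finset.mem_insert.1 hq with rfl | hq
      · exact he0
      · exact (Finset.mem_filter.1 hq).2
    · have h1 : ((insert (e, (0 : ℝ)) (Q.filter fun q => q.1 ≠ 0)).card : ℝ) ≤ Q.card + 1 := by
        exact_mod_cast (Finset.card_insert_le _ _).trans
          (Nat.add_le_add_right (Finset.card_filter_le _ _) 1)
      rw [htd] at hQ
      nlinarith
    · intro m parts Δ hdisj hparts hpcard hΔ hsub κ₀ hκ₀ a b ha
      have hκ : 0 ≤ κ₀ := le_trans (Nat.cast_nonneg _) (hκ₀ _ (Finset.mem_insert_self _ _))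
      have key := meetCount_le hk hdisj (fun i p hp => (hparts p).2 ⟨i, hp⟩) hpcard hΔ hsub hW hQW
        hκ (fun q hq hq0 => hκ₀ q
          (Finset.mem_insert_of_mem (Finset.mem_filter.2 ⟨hq, hq0⟩))) b ha
      rw [hcard, hdiv] at key
      refine key.trans (add_le_add_right ?_ _)
      nlinarith
end
end
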